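/- Suppose λ(X) ≠ 0 for every dense X ∈ L ∖ {V}. Then the set of residue classes {[Ξ(B)] : B ∈ βnbc(𝒜)}, indexed by the standard ordered βnbc-bases of 𝒜, is a ℂ-basis of the top cohomology H^r(A^•, ω_λ∧) = A^r / (ω_λ ∧ A^{r−1}) of the Orlik–Solomon complex. -/

import Mathlib

open Module

noncomputable section

/-- An arrangement of `n` (affine) hyperplanes inside the ambient affine subspace `amb`
of the complex vector space `W`.  The linear order on the hyperplanes is the order of the
indices in `Fin n`; an arbitrary linear order is encoded by a permutation `σ` of `Fin n`,
with `i ≺ j ↔ σ i < σ j`. -/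
structure HArr (W : Type) [AddCommGroup W] [Module ℂ W] (n : ℕ) where
  amb : AffineSubspace ℂ W
  amb_ne : (amb : Set W).Nonempty
  H : Fin n → AffineSubspace ℂ W
  inj : Function.Injective H
  le_amb : ∀ i, H i ≤ amb
  nonemptyH : ∀ i, ((H i : Set W)).Nonempty
  hyp : ∀ i, finrank ℂ (H i).direction + 1 = finrank ℂ amb.direction

namespace HArr

variable {W : Type} [AddCommGroup W] [Module ℂ W] {n : ℕ}

/-- The intersection `⋂ S` of a subset of the arrangement (the ambient space for `S = ∅`). -/
def inter (A : HArr W n) (S : Finset (Fin n)) : AffineSubspace ℂ W :=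
  A.amb ⊓ S.inf A.H

/-- Codimension (inside the ambient space) of an affine subspace. -/
def cd (A : HArr W n) (X : AffineSubspace ℂ W) : ℕ :=
  finrank ℂ A.amb.direction - finrank ℂ X.direction

/-- A dependent subset of the arrangement. -/
def dep (A : HArr W n) (S : Finset (Fin n)) : Prop :=
  A.inter S ≠ ⊥ ∧ A.cd (A.inter S) < S.card

/-- An independent subset of the arrangement. -/
def indep (A : HArr W n) (S : Finset (Fin n)) : Prop :=
  A.inter S ≠ ⊥ ∧ A.cd (A.inter S) = S.card

/-- A base: a maximal independent subset. -/
def isBase (A : HArr W n) (S : Finset (Fin n)) : Prop :=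
  A.indep S ∧ ∀ T, A.indep T → S ⊆ T → S = T

open scoped Classical in
/-- The rank of a subarrangement `{H i : i ∈ C}`. -/
def rankOn (A : HArr W n) (C : Finset (Fin n)) : ℕ :=
  C.powerset.sup fun S => if A.indep S then S.card else 0

/-- The rank `r` of the arrangement. -/
def rank (A : HArr W n) : ℕ := A.rankOn Finset.univ

/-- A circuit: an inclusion-minimal dependent set. -/
def circuit (A : HArr W n) (S : Finset (Fin n)) : Prop :=
  A.dep S ∧ ∀ T ⊂ S, ¬ A.dep T

/-- A broken circuit w.r.t. the linear order given by `σ`. -/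
def brokenCircuit (A : HArr W n) (σ : Equiv.Perm (Fin n)) (S : Finset (Fin n)) : Prop :=
  ∃ i ∉ S, (∀ j ∈ S, σ i < σ j) ∧ A.circuit (insert i S)

/-- An nbc set: nonempty intersection and containing no broken circuit. -/
def nbcSet (A : HArr W n) (σ : Equiv.Perm (Fin n)) (S : Finset (Fin n)) : Prop :=
  A.inter S ≠ ⊥ ∧ ∀ T ⊆ S, ¬ A.brokenCircuit σ T

/-- An nbc-base. -/
def nbcBase (A : HArr W n) (σ : Equiv.Perm (Fin n)) (S : Finset (Fin n)) : Prop :=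
  A.nbcSet σ S ∧ A.isBase S

/-- A βnbc-base. -/
def betaNbcBase (A : HArr W n) (σ : Equiv.Perm (Fin n)) (S : Finset (Fin n)) : Prop :=
  A.nbcBase σ S ∧ ∀ i ∈ S, ∃ j, σ j < σ i ∧ A.isBase (insert j (S.erase i))

/-- Membership in the intersection poset `L(𝒜)`. -/
def memL (A : HArr W n) (X : AffineSubspace ℂ W) : Prop :=
  X ≠ ⊥ ∧ ∃ S : Finset (Fin n), A.inter S = X

/-- A maximal element of `L(𝒜)` (in the reverse-inclusion order). -/
def maximalL (A : HArr W n) (X : AffineSubspace ℂ W) : Prop :=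
  A.memL X ∧ ∀ Y, A.memL Y → Y ≤ X → Y = X

open scoped Classical in
/-- The set of indices of hyperplanes containing `X`, i.e. `𝒜_X`. -/
def sub (A : HArr W n) (X : AffineSubspace ℂ W) : Finset (Fin n) :=
  Finset.univ.filter fun i => X ≤ A.H i

/-- `X` is dense: `𝒜_X` admits no decomposition into two nonempty parts. -/
def denseL (A : HArr W n) (X : AffineSubspace ℂ W) : Prop :=
  ¬ ∃ S T : Finset (Fin n), Disjoint S T ∧ S.Nonempty ∧ T.Nonempty ∧
      S ∪ T = A.sub X ∧ A.cd (A.inter S) + A.cd (A.inter T) = A.cd X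

/-- `i` is the minimum of `S` w.r.t. the linear order given by `σ`. -/
def isMin (σ : Equiv.Perm (Fin n)) (i : Fin n) (S : Finset (Fin n)) : Prop :=
  i ∈ S ∧ ∀ j ∈ S, σ i ≤ σ j

/-- The standard ordered tuple of a finite set, w.r.t. the linear order given by `σ`:
`tup σ S p` is the element of `S` with `(p+1)`-st smallest `σ`-value. -/
def tup (σ : Equiv.Perm (Fin n)) (S : Finset (Fin n)) (p : Fin S.card) : Fin n :=
  σ.symm (((S.image ⇑σ).orderIsoOfFin (Finset.card_image_of_injective S σ.injective) p).1)

/-- The flag `ξ(B) = (X_1 > ⋯ > X_r)` of a standard ordered base: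
`flag σ S p = X_{p+1} = ⋂_{k ≥ p} H_{i_k}`. -/
def flag (A : HArr W n) (σ : Equiv.Perm (Fin n)) (S : Finset (Fin n)) (p : Fin S.card) :
    AffineSubspace ℂ W :=
  A.inter (S.filter fun i => σ (tup σ S p) ≤ σ i)

/-- Lexicographic order on standard ordered tuples (for the canonical order). -/
def lexLt (S T : Finset (Fin n)) : Prop :=
  List.Lex (· < ·) (S.sort (· ≤ ·)) (T.sort (· ≤ ·))

/-- `λ(X) = Σ_{H_i ∈ 𝒜_X} λ_i`. -/
def lamX (A : HArr W n) (lam : Fin n → ℂ) (X : AffineSubspace ℂ W) : ℂ :=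
  ∑ i ∈ A.sub X, lam i

/-- `X` is unmixed (w.r.t. the order `σ`). -/
def unmixedX (A : HArr W n) (σ : Equiv.Perm (Fin n)) (X : AffineSubspace ℂ W) : Prop :=
  (∀ S, A.nbcBase σ S → A.inter S = X → A.betaNbcBase σ S) ∨
  (∀ S, A.nbcBase σ S → A.inter S = X → ¬ A.betaNbcBase σ S)

/-- The linear order given by `σ` is unmixed. -/
def unmixedOrd (A : HArr W n) (σ : Equiv.Perm (Fin n)) : Prop :=
  ∀ X, A.maximalL X → A.unmixedX σ X

/-- Membership in the intersection poset of the deleted arrangement `𝒜 ∖ {H_{i₀}}`. -/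
def memLdel (A : HArr W n) (i₀ : Fin n) (X : AffineSubspace ℂ W) : Prop :=
  X ≠ ⊥ ∧ ∃ S : Finset (Fin n), i₀ ∉ S ∧ A.inter S = X

/-- A maximal element of the intersection poset of the deleted arrangement. -/
def maximalLdel (A : HArr W n) (i₀ : Fin n) (X : AffineSubspace ℂ W) : Prop :=
  A.memLdel i₀ X ∧ ∀ Y, A.memLdel i₀ Y → Y ≤ X → Y = X

/-- The generator `e_i` of the exterior algebra `E`. -/
def gen (i : Fin n) : ExteriorAlgebra ℂ (Fin n → ℂ) :=
  ExteriorAlgebra.ι ℂ (Pi.single i 1)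

/-- `e_S = e_{i_1} ∧ ⋯ ∧ e_{i_p}` for `S = {i_1 < ⋯ < i_p}`. -/
def eS (S : Finset (Fin n)) : ExteriorAlgebra ℂ (Fin n → ℂ) :=
  ((S.sort (· ≤ ·)).map gen).prod

/-- `∂e_S = Σ_k (−1)^{k−1} e_{S ∖ {i_k}}`. -/
def bdry (S : Finset (Fin n)) : ExteriorAlgebra ℂ (Fin n → ℂ) :=
  ∑ i ∈ S, ((-1 : ℂ) ^ (S.filter fun j => j < i).card) • eS (S.erase i)

/-- The defining relations of the Orlik–Solomon algebra. -/
inductive OSRel (A : HArr W n) :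
    ExteriorAlgebra ℂ (Fin n → ℂ) → ExteriorAlgebra ℂ (Fin n → ℂ) → Prop
  | isBot : ∀ S : Finset (Fin n), A.inter S = ⊥ → OSRel A (eS S) 0
  | isDep : ∀ S : Finset (Fin n), A.dep S → OSRel A (bdry S) 0

/-- The Orlik–Solomon algebra `A(𝒜)`: the exterior algebra modulo the ideal generated by
the `e_S` with empty intersection and the `∂e_S` with `S` dependent. -/
abbrev OS (A : HArr W n) := RingQuot (OSRel A)

/-- The quotient map `E → A(𝒜)`. -/
def osMk (A : HArr W n) : ExteriorAlgebra ℂ (Fin n → ℂ) →ₐ[ℂ] OS A :=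
  RingQuot.mkAlgHom ℂ (OSRel A)

/-- `ω_i`, the image of `e_i` in the Orlik–Solomon algebra. -/
def om (A : HArr W n) (i : Fin n) : OS A := osMk A (gen i)

/-- `ω_B`, the image of `e_B` in the Orlik–Solomon algebra. -/
def omB (A : HArr W n) (S : Finset (Fin n)) : OS A := osMk A (eS S)

/-- The degree `p` part `A^p` of the Orlik–Solomon algebra. -/
def deg (A : HArr W n) (p : ℕ) : Submodule ℂ (OS A) :=
  Submodule.span ℂ {x | ∃ S : Finset (Fin n), S.card = p ∧ x = omB A S}

/-- `ω_λ = Σ_i λ_i ω_i`. -/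
def omLam (A : HArr W n) (lam : Fin n → ℂ) : OS A := ∑ i, lam i • om A i

/-- `ω_λ(X) = Σ_{H_i ∈ 𝒜_X} λ_i ω_i`. -/
def omLamX (A : HArr W n) (lam : Fin n → ℂ) (X : AffineSubspace ℂ W) : OS A :=
  ∑ i ∈ A.sub X, lam i • om A i

/-- The form `Ξ(B) = ω_λ(X_1) ⋯ ω_λ(X_r)` attached to a standard ordered base. -/
def Xi (A : HArr W n) (σ : Equiv.Perm (Fin n)) (lam : Fin n → ℂ) (S : Finset (Fin n)) :
    OS A :=
  ((List.finRange S.card).map fun p => A.omLamX lam (A.flag σ S p)).prod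

/-- The submodule `ω_λ ∧ A^p` of the Orlik-Solomon algebra. -/
def Ideg (A : HArr W n) (lam : Fin n → ℂ) (p : ℕ) : Submodule ℂ (OS A) :=
  (A.deg p).map (LinearMap.mulLeft ℂ (A.omLam lam))

end HArr

namespace HArr

variable {W : Type} [AddCommGroup W] [Module ℂ W] {n : ℕ}

/-! ### The exterior algebra -/

/-- The sign `(-1) ^ #{j ∈ S | j < i}`. -/
def sg (i : Fin n) (S : Finset (Fin n)) : ℂ := (-1) ^ (S.filter fun j => j < i).card

theorem sg_mul_self (i : Fin n) (S : Finset (Fin n)) : sg i S * sg i S = 1 := by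
  rw [sg, ← mul_pow]; simp

theorem sg_ne_zero (i : Fin n) (S : Finset (Fin n)) : sg i S ≠ 0 :=
  fun h => by simpa [h] using sg_mul_self i S

theorem sg_insert_self (i : Fin n) (S : Finset (Fin n)) : sg i (insert i S) = sg i S := by
  simp [sg, Finset.filter_insert]

theorem sg_erase_self (i : Fin n) (S : Finset (Fin n)) : sg i (S.erase i) = sg i S := by
  rw [sg, sg, Finset.filter_erase, Finset.erase_eq_of_notMem (by simp)]

theorem sg_insert_lt {a i : Fin n} {S : Finset (Fin n)} (ha : a ∉ S) (h : a < i) :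
    sg i (insert a S) = -sg i S := by
  rw [sg, sg, Finset.filter_insert, if_pos h, Finset.card_insert_of_notMem (by simp [ha]), pow_succ]
  ring

theorem sg_eq_one {i : Fin n} {S : Finset (Fin n)} (h : ∀ j ∈ S, i ≤ j) : sg i S = 1 := by
  rw [sg, Finset.filter_false_of_mem (fun j hj => (h j hj).not_gt)]; simp

@[simp] theorem eS_empty : eS (∅ : Finset (Fin n)) = 1 := by simp [eS]

theorem eS_insert_min {a : Fin n} {S : Finset (Fin n)} (h : ∀ j ∈ S, a < j) :
    eS (insert a S) = gen a * eS S := by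
  rw [eS, Finset.sort_insert _ (fun b hb => (h b hb).le) (fun ha => (h a ha).false)]
  simp [eS]

theorem eS_singleton (a : Fin n) : eS {a} = gen a := by
  simpa using eS_insert_min (a := a) (S := ∅) (by simp)

/-- The monomial basis of the exterior algebra. -/
def monomialBasis (n : ℕ) : Basis (Finset (Fin n)) ℂ (ExteriorAlgebra ℂ (Fin n → ℂ)) :=
  (Pi.basisFun ℂ (Fin n)).ExteriorAlgebra

theorem monomialBasis_apply (S : Finset (Fin n)) : monomialBasis n S = eS S := by
  rw [monomialBasis, ExteriorAlgebra.basis_apply_ofCard _ rfl, eS]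
  refine (ExteriorAlgebra.ιMulti_apply _).trans ?_
  rw [← Finset.listMap_orderEmbOfFin_finRange S rfl, List.ofFn_eq_map, List.map_map]
  congr 1
  refine List.map_congr_left fun i _ => ?_
  simp only [Function.comp, gen, Pi.basisFun_apply]
  rfl

theorem linearMap_ext_eS {M : Type*} [AddCommGroup M] [Module ℂ M]
    {f g : ExteriorAlgebra ℂ (Fin n → ℂ) →ₗ[ℂ] M} (h : ∀ S, f (eS S) = g (eS S)) : f = g :=
  (monomialBasis n).ext fun S => by simpa only [monomialBasis_apply] using h S

theorem gen_mul_self (i : Fin n) : gen i * gen i = 0 := ExteriorAlgebra.ι_sq_zero _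

theorem gen_mul_gen (i j : Fin n) : gen i * gen j = -(gen j * gen i) :=
  eq_neg_of_add_eq_zero_left (ExteriorAlgebra.ι_add_mul_swap _ _)

theorem gen_mul_eS_aux (S : Finset (Fin n)) : ∀ i,
    (i ∈ S → gen i * eS S = 0) ∧ (i ∉ S → gen i * eS S = sg i S • eS (insert i S)) := by
  induction S using Finset.induction_on_min with
  | empty =>
    refine fun i => ⟨by simp, fun _ => ?_⟩
    rw [sg_eq_one (by simp)]
    simp [eS_singleton]
  | insert a S ha ih =>
    have haS : a ∉ S := fun h => (ha a h).false
    intro i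
    rw [eS_insert_min ha]
    rcases lt_trichotomy i a with hia | rfl | hia
    · have h1 : ∀ j ∈ insert a S, i < j := by
        intro j hj
        rcases Finset.mem_insert.1 hj with rfl | hj
        exacts [hia, hia.trans (ha j hj)]
      refine ⟨fun h => absurd (h1 i h) (lt_irrefl _), fun _ => ?_⟩
      rw [sg_eq_one (fun j hj => (h1 j hj).le), eS_insert_min h1, eS_insert_min ha, one_smul]
    · refine ⟨fun _ => ?_, fun h => absurd (Finset.mem_insert_self _ _) h⟩
      rw [← mul_assoc, gen_mul_self, zero_mul]
    · rw [← mul_assoc, gen_mul_gen, neg_mul, mul_assoc]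
      refine ⟨fun h => ?_, fun h => ?_⟩
      · rw [(ih i).1 (Finset.mem_of_mem_insert_of_ne h hia.ne'), mul_zero, neg_zero]
      · have hi : i ∉ S := fun h' => h (Finset.mem_insert_of_mem h')
        rw [(ih i).2 hi, mul_smul_comm, sg_insert_lt haS hia, neg_smul, Finset.insert_comm,
          eS_insert_min (S := insert i S)]
        intro j hj
        rcases Finset.mem_insert.1 hj with rfl | hj
        exacts [hia, ha j hj]

theorem gen_mul_eS_of_mem {i : Fin n} {S : Finset (Fin n)} (h : i ∈ S) : gen i * eS S = 0 :=
  (gen_mul_eS_aux S i).1 h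

theorem gen_mul_eS {i : Fin n} {S : Finset (Fin n)} (h : i ∉ S) :
    gen i * eS S = sg i S • eS (insert i S) :=
  (gen_mul_eS_aux S i).2 h

theorem eS_mul_eS_of_disjoint {U T : Finset (Fin n)} (h : Disjoint U T) :
    ∃ ε : ℂ, ε ≠ 0 ∧ eS U * eS T = ε • eS (U ∪ T) := by
  induction U using Finset.induction_on_min with
  | empty => exact ⟨1, one_ne_zero, by simp⟩
  | insert a S ha ih =>
    rw [Finset.disjoint_insert_left] at h
    obtain ⟨ε, hε, he⟩ := ih h.2
    have haS : a ∉ S ∪ T := by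
      simpa [h.1] using fun h' => (ha a h').false
    refine ⟨ε * sg a (S ∪ T), mul_ne_zero hε (sg_ne_zero _ _), ?_⟩
    rw [eS_insert_min ha, mul_assoc, he, mul_smul_comm, gen_mul_eS haS, smul_smul,
      Finset.insert_union]

theorem eS_mul_eS_of_not_disjoint {U T : Finset (Fin n)} (h : ¬ Disjoint U T) :
    eS U * eS T = 0 := by
  induction U using Finset.induction_on_min with
  | empty => exact absurd (Finset.disjoint_empty_left T) h
  | insert a S ha ih =>
    rw [eS_insert_min ha, mul_assoc]
    by_cases hS : Disjoint S T
    · obtain ⟨ε, -, he⟩ := eS_mul_eS_of_disjoint hS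
      have haT : a ∈ T := by
        by_contra haT
        exact h (Finset.disjoint_insert_left.2 ⟨haT, hS⟩)
      rw [he, mul_smul_comm, gen_mul_eS_of_mem (Finset.mem_union_right _ haT), smul_zero]
    · rw [ih hS, mul_zero]

theorem eS_mul_ι (S : Finset (Fin n)) (v : Fin n → ℂ) :
    eS S * ExteriorAlgebra.ι ℂ v = (-1 : ℂ) ^ S.card • (ExteriorAlgebra.ι ℂ v * eS S) := by
  induction S using Finset.induction_on_min with
  | empty => simp
  | insert a S ha ih =>
    rw [eS_insert_min ha, Finset.card_insert_of_notMem (fun h => (ha a h).false), mul_assoc, ih,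
      mul_smul_comm, ← mul_assoc, ← mul_assoc, gen,
      eq_neg_of_add_eq_zero_left (ExteriorAlgebra.ι_add_mul_swap (R := ℂ) (Pi.single a 1) v),
      pow_succ, neg_mul, smul_neg, mul_neg_one, neg_smul]

/-- The contraction (interior product) with the linear form with coordinates `d`. -/
def ctr (d : Fin n → ℂ) :
    ExteriorAlgebra ℂ (Fin n → ℂ) →ₗ[ℂ] ExteriorAlgebra ℂ (Fin n → ℂ) :=
  CliffordAlgebra.contractLeft (∑ i, d i • LinearMap.proj i)

theorem ctr_gen_mul (d : Fin n → ℂ) (i : Fin n) (x : ExteriorAlgebra ℂ (Fin n → ℂ)) :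
    ctr d (gen i * x) = d i • x - gen i * ctr d x := by
  rw [ctr, gen, ExteriorAlgebra.ι, CliffordAlgebra.contractLeft_ι_mul]
  simp [Pi.single_apply]

theorem ctr_ctr (d : Fin n → ℂ) (x : ExteriorAlgebra ℂ (Fin n → ℂ)) : ctr d (ctr d x) = 0 :=
  CliffordAlgebra.contractLeft_contractLeft _ _

theorem ctr_eS (d : Fin n → ℂ) (S : Finset (Fin n)) :
    ctr d (eS S) = ∑ i ∈ S, (d i * sg i S) • eS (S.erase i) := by
  induction S using Finset.induction_on_min with
  | empty => simp [ctr]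
  | insert a S ha ih =>
    have haS : a ∉ S := fun h => (ha a h).false
    rw [eS_insert_min ha, ctr_gen_mul, ih, Finset.sum_insert haS, Finset.erase_insert haS,
      sg_insert_self, sg_eq_one (fun j hj => (ha j hj).le), mul_one, sub_eq_add_neg, Finset.mul_sum,
      ← Finset.sum_neg_distrib]
    congr 1
    refine Finset.sum_congr rfl fun i hi => ?_
    rw [Finset.erase_insert_of_ne (ha i hi).ne, sg_insert_lt haS (ha i hi),
      eS_insert_min (fun j hj => ha j (Finset.mem_of_mem_erase hj)), mul_smul_comm, mul_neg,
      neg_smul]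

/-- The boundary operator: the contraction with the sum of all coordinates. -/
abbrev del : ExteriorAlgebra ℂ (Fin n → ℂ) →ₗ[ℂ] ExteriorAlgebra ℂ (Fin n → ℂ) := ctr 1

theorem del_eS (S : Finset (Fin n)) : del (eS S) = bdry S := by
  rw [del, ctr_eS, bdry]
  simp [sg]

/-- The graded Leibniz rule for a monomial. -/
theorem ctr_eS_mul (d : Fin n → ℂ) (S : Finset (Fin n)) (x : ExteriorAlgebra ℂ (Fin n → ℂ)) :
    ctr d (eS S * x) = ctr d (eS S) * x + (-1 : ℂ) ^ S.card • (eS S * ctr d x) := by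
  induction S using Finset.induction_on_min with
  | empty => simp [ctr]
  | insert a S ha ih =>
    rw [eS_insert_min ha, Finset.card_insert_of_notMem (fun h => (ha a h).false), mul_assoc,
      ctr_gen_mul, ih, ctr_gen_mul, pow_succ, sub_mul, mul_add, mul_smul_comm, mul_assoc,
      smul_mul_assoc, mul_neg_one, neg_smul, mul_assoc]
    abel

theorem ctr_eS_eq_zero {d : Fin n → ℂ} {S : Finset (Fin n)} (h : ∀ i ∈ S, d i = 0) :
    ctr d (eS S) = 0 := by
  rw [ctr_eS]
  exact Finset.sum_eq_zero fun i hi => by simp [h i hi]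

theorem ctr_eS_eq_bdry {d : Fin n → ℂ} {S : Finset (Fin n)} (h : ∀ i ∈ S, d i = 1) :
    ctr d (eS S) = bdry S := by
  rw [ctr_eS, bdry]
  exact Finset.sum_congr rfl fun i hi => by simp [h i hi, sg]

/-- The form `∑_S λ_S φ(e_S) e_S` attached to a functional `φ` on the exterior algebra. -/
def dualForm (lam : Fin n → ℂ) :
    Dual ℂ (ExteriorAlgebra ℂ (Fin n → ℂ)) →ₗ[ℂ] ExteriorAlgebra ℂ (Fin n → ℂ) where
  toFun φ := ∑ S, ((∏ i ∈ S, lam i) * φ (eS S)) • eS S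
  map_add' φ ψ := by
    simp only [LinearMap.add_apply, mul_add, add_smul, Finset.sum_add_distrib]
  map_smul' c φ := by
    simp only [LinearMap.smul_apply, smul_eq_mul, RingHom.id_apply, Finset.smul_sum, smul_smul,
      mul_left_comm]

theorem dualForm_apply (lam : Fin n → ℂ) (φ : Dual ℂ (ExteriorAlgebra ℂ (Fin n → ℂ))) :
    dualForm lam φ = ∑ S, ((∏ i ∈ S, lam i) * φ (eS S)) • eS S := rfl

/-- Contraction is dual to exterior multiplication. -/
theorem dualForm_comp_ctr (lam d : Fin n → ℂ) (φ : Dual ℂ (ExteriorAlgebra ℂ (Fin n → ℂ))) :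
    dualForm lam (φ ∘ₗ ctr d) = (∑ i, (lam i * d i) • gen i) * dualForm lam φ := by
  have hr : (∑ i, (lam i * d i) • gen i) * dualForm lam φ =
      ∑ T, ∑ i ∈ Finset.univ.filter (fun i : Fin n => i ∉ T),
        (lam i * d i * ((∏ i ∈ T, lam i) * φ (eS T)) * sg i T) • eS (insert i T) := by
    rw [dualForm_apply, Finset.mul_sum]
    refine Finset.sum_congr rfl fun T _ => ?_
    rw [Finset.sum_mul, Finset.sum_filter]
    refine Finset.sum_congr rfl fun i _ => ?_
    rw [smul_mul_smul_comm]
    split_ifs with h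
    · rw [gen_mul_eS_of_mem h, smul_zero]
    · rw [gen_mul_eS h, smul_smul]
  have hl : dualForm lam (φ ∘ₗ ctr d) = ∑ S, ∑ i ∈ S,
      ((∏ i ∈ S, lam i) * (d i * sg i S * φ (eS (S.erase i)))) • eS S := by
    rw [dualForm_apply]
    refine Finset.sum_congr rfl fun S _ => ?_
    rw [LinearMap.comp_apply, ctr_eS, map_sum, Finset.mul_sum, Finset.sum_smul]
    simp only [map_smul, smul_eq_mul]
  rw [hl, hr, Finset.sum_sigma', Finset.sum_sigma']
  refine Finset.sum_bij' (fun p _ => ⟨p.1.erase p.2, p.2⟩) (fun p _ => ⟨insert p.2 p.1, p.2⟩)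
    ?_ ?_ ?_ ?_ ?_
  · rintro ⟨S, i⟩ h; simp
  · rintro ⟨S, i⟩ h; simp
  · rintro ⟨S, i⟩ h
    simp only [Finset.mem_sigma, Finset.mem_univ, true_and] at h
    simp [Finset.insert_erase h]
  · rintro ⟨S, i⟩ h
    simp only [Finset.mem_sigma, Finset.mem_univ, true_and, Finset.mem_filter] at h
    simp [Finset.erase_insert h]
  · rintro ⟨S, i⟩ h
    simp only [Finset.mem_sigma, Finset.mem_univ, true_and] at h
    simp only [Finset.insert_erase h, sg_erase_self, ← Finset.mul_prod_erase S lam h]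
    congr 1
    ring

/-! ### Simplicial cochains and shellings -/

/-- The simplicial coboundary of a cochain. -/
def cob (χ : Finset (Fin n) → ℂ) (S : Finset (Fin n)) : ℂ := ∑ i ∈ S, sg i S * χ (S.erase i)

theorem cob_cob (χ : Finset (Fin n) → ℂ) (S : Finset (Fin n)) : cob (cob χ) S = 0 := by
  have h : ∀ T, (monomialBasis n).constr ℂ χ (del (eS T)) = cob χ T := by
    intro T
    rw [del, ctr_eS, map_sum, cob]
    refine Finset.sum_congr rfl fun i _ => ?_
    rw [map_smul, ← monomialBasis_apply, Basis.constr_basis]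
    simp
  have h2 := congrArg ((monomialBasis n).constr ℂ χ) (ctr_ctr 1 (eS S))
  rw [map_zero, ctr_eS, map_sum, map_sum] at h2
  rw [cob, ← h2]
  refine Finset.sum_congr rfl fun i _ => ?_
  rw [map_smul, map_smul, ← h]
  simp

/-- In a shelling `w` of the facets `𝓑`, with `F \ N F` the restriction of the facet `F`, a
codimension-one cochain that is closed on all facets with `N F ≠ ∅` is a coboundary. -/
theorem exists_cob_eq_of_shelling (𝓑 : Finset (Finset (Fin n)))
    (N : Finset (Fin n) → Finset (Fin n)) (w : Finset (Fin n) → ℕ) (r : ℕ)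
    (hcard : ∀ F ∈ 𝓑, F.card = r) (hN : ∀ F ∈ 𝓑, N F ⊆ F)
    (h1 : ∀ F ∈ 𝓑, ∀ i ∈ F, i ∉ N F → ∃ F' ∈ 𝓑, F.erase i ⊆ F' ∧ w F' < w F)
    (h2 : ∀ F ∈ 𝓑, ∀ k ∈ N F, ∀ l ∈ N F, ∀ F' ∈ 𝓑, (F.erase k).erase l ⊆ F' → F' ≠ F →
      w F < w F')
    (ψ : Finset (Fin n) → ℂ) (hψ : ∀ F ∈ 𝓑, (N F).Nonempty → cob ψ F = 0)
    (s : Finset (Finset (Fin n))) (hs : s ⊆ 𝓑)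
    (hdown : ∀ F ∈ s, ∀ F' ∈ 𝓑, w F' < w F → F' ∈ s) :
    ∃ χ : Finset (Fin n) → ℂ, ∀ F ∈ s, ∀ i ∈ F, ψ (F.erase i) = cob χ (F.erase i) := by
  induction s using Finset.induction_on_max_value w with
  | empty => exact ⟨0, by simp⟩
  | insert F s hFs hmax ih =>
    have hF : F ∈ 𝓑 := hs (Finset.mem_insert_self _ _)
    obtain ⟨χ, hχ⟩ := ih (fun G hG => hs (Finset.mem_insert_of_mem hG)) (by
      intro G hG G' hG' hw
      refine Finset.mem_of_mem_insert_of_ne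
        (hdown G (Finset.mem_insert_of_mem hG) G' hG' hw) ?_
      rintro rfl
      exact (hmax G hG).not_gt hw)
    have hold : ∀ χ' : Finset (Fin n) → ℂ,
        (∀ G ∈ s, ∀ i ∈ G, ψ (G.erase i) = cob χ' (G.erase i)) →
        ∀ i ∈ F, i ∉ N F → ψ (F.erase i) = cob χ' (F.erase i) := by
      intro χ' hχ' i hi hiN
      obtain ⟨G, hG, hsub, hw⟩ := h1 F hF i hi hiN
      have hGs : G ∈ s := by
        refine Finset.mem_of_mem_insert_of_ne
          (hdown F (Finset.mem_insert_self _ _) G hG hw) ?_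
        rintro rfl
        exact hw.false
      have hex : ∃ j ∈ G, j ∉ F.erase i := by
        by_contra hcon
        push Not at hcon
        have := Finset.card_le_card (fun j hj => hcon j hj : G ⊆ F.erase i)
        rw [Finset.card_erase_of_mem hi, hcard F hF, hcard G hG] at this
        have hr : 0 < F.card := Finset.card_pos.2 ⟨i, hi⟩
        rw [hcard F hF] at hr
        omega
      obtain ⟨j, hj, hjn⟩ := hex
      have : F.erase i = G.erase j := by
        refine Finset.eq_of_subset_of_card_le (Finset.subset_erase.2 ⟨hsub, hjn⟩) ?_
        rw [Finset.card_erase_of_mem hi, Finset.card_erase_of_mem hj, hcard F hF, hcard G hG]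
      rw [this]
      exact hχ' G hGs j hj
    rcases (N F).eq_empty_or_nonempty with hNe | ⟨k, hk⟩
    · refine ⟨χ, fun G hG => ?_⟩
      rcases Finset.mem_insert.1 hG with rfl | hG
      · exact fun i hi => hold χ hχ i hi (by simp [hNe])
      · exact hχ G hG
    have hkF : k ∈ F := hN F hF hk
    -- the new codimension-two faces are the `F \ {k, l}` with `l ∈ N F`
    let χ' : Finset (Fin n) → ℂ := fun T => χ T + ∑ l ∈ (N F).erase k,
      if T = (F.erase l).erase k then
        sg k (F.erase l) * (ψ (F.erase l) - cob χ (F.erase l)) else 0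
    have hs' : ∀ G ∈ s, ∀ i ∈ G, ψ (G.erase i) = cob χ' (G.erase i) := by
      intro G hG i hi
      rw [hχ G hG i hi, cob, cob]
      refine Finset.sum_congr rfl fun m _ => ?_
      congr 1
      rw [left_eq_add]
      refine Finset.sum_eq_zero fun l hl => if_neg fun h => ?_
      refine (hmax G hG).not_gt (h2 F hF l (Finset.mem_of_mem_erase hl) k hk G
        (hs (Finset.mem_insert_of_mem hG)) ?_ ?_)
      · rw [← h]
        exact (Finset.erase_subset _ _).trans (Finset.erase_subset _ _)
      · rintro rfl
        exact hFs hG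
    have hl : ∀ l ∈ N F, l ≠ k → ψ (F.erase l) = cob χ' (F.erase l) := by
      intro l hl hlk
      have hkl : k ∈ F.erase l := Finset.mem_erase.2 ⟨hlk.symm, hkF⟩
      have hlF := hN F hF hl
      have key : cob χ' (F.erase l) = cob χ (F.erase l) +
          sg k (F.erase l) * (sg k (F.erase l) * (ψ (F.erase l) - cob χ (F.erase l))) := by
        rw [cob, ← Finset.add_sum_erase _ _ hkl]
        rw [show cob χ (F.erase l) = _ from (Finset.add_sum_erase _ _ hkl).symm]
        rw [Finset.sum_congr rfl (g := fun m => sg m (F.erase l) * χ ((F.erase l).erase m))]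
        · simp only [χ']
          rw [Finset.sum_eq_single_of_mem l (Finset.mem_erase.2 ⟨hlk, hl⟩), if_pos rfl]
          · rw [show cob χ (F.erase l) = _ from (Finset.add_sum_erase _ _ hkl).symm]
            ring
          · intro l' hl' hne
            refine if_neg fun h => ?_
            have hl'F := hN F hF (Finset.mem_of_mem_erase hl')
            have : l' ∈ (F.erase l).erase k := by
              simp [hne, hl'F, Finset.ne_of_mem_erase hl']
            rw [h] at this
            simp at this
        · intro m hm
          congr 1
          rw [add_eq_left]
          refine Finset.sum_eq_zero fun l' hl' => if_neg fun h => ?_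
          have : k ∈ (F.erase l).erase m := by
            simp [hkF, hlk.symm, (Finset.ne_of_mem_erase hm).symm]
          rw [h] at this
          simp at this
      rw [key, ← mul_assoc, sg_mul_self]
      ring
    refine ⟨χ', fun G hG => ?_⟩
    rcases Finset.mem_insert.1 hG with rfl | hG
    · have hne : ∀ i ∈ G, i ≠ k → ψ (G.erase i) = cob χ' (G.erase i) := by
        intro i hi hik
        by_cases hiN : i ∈ N G
        exacts [hl i hiN hik, hold χ' hs' i hi hiN]
      intro i hi
      by_cases hik : i = k
      · subst hik
        have e1 := hψ G hF ⟨i, hk⟩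
        have e2 := cob_cob χ' G
        rw [cob, ← Finset.add_sum_erase _ _ hkF] at e1 e2
        rw [Finset.sum_congr rfl (g := fun j => sg j G * cob χ' (G.erase j))] at e1
        · have := e1.trans e2.symm
          exact mul_left_cancel₀ (sg_ne_zero _ _) (add_right_cancel this)
        · intro j hj
          rw [hne j (Finset.mem_of_mem_erase hj) (Finset.ne_of_mem_erase hj)]
      · exact hne i hi hik
    · exact hs' G hG

theorem cob_eq_zero_of_shelling (𝓑 : Finset (Finset (Fin n)))
    (N : Finset (Fin n) → Finset (Fin n)) (w : Finset (Fin n) → ℕ) (r : ℕ)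
    (hcard : ∀ F ∈ 𝓑, F.card = r) (hN : ∀ F ∈ 𝓑, N F ⊆ F)
    (h1 : ∀ F ∈ 𝓑, ∀ i ∈ F, i ∉ N F → ∃ F' ∈ 𝓑, F.erase i ⊆ F' ∧ w F' < w F)
    (h2 : ∀ F ∈ 𝓑, ∀ k ∈ N F, ∀ l ∈ N F, ∀ F' ∈ 𝓑, (F.erase k).erase l ⊆ F' → F' ≠ F →
      w F < w F')
    (ψ : Finset (Fin n) → ℂ) (hψ : ∀ F ∈ 𝓑, (N F).Nonempty → cob ψ F = 0) :
    ∀ F ∈ 𝓑, cob ψ F = 0 := by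
  obtain ⟨χ, hχ⟩ := exists_cob_eq_of_shelling 𝓑 N w r hcard hN h1 h2 ψ hψ 𝓑 subset_rfl
    (fun _ _ F' hF' _ => hF')
  intro F hF
  rw [← cob_cob χ F, cob, cob]
  exact Finset.sum_congr rfl fun i hi => by rw [hχ F hF i hi]

/-! ### Normal covectors -/

theorem mem_span_dual_iff {V : Type*} [AddCommGroup V] [Module ℂ V] (ν : Fin n → Dual ℂ V)
    (S : Finset (Fin n)) (f : Dual ℂ V) :
    f ∈ Submodule.span ℂ (ν '' S) ↔ ∀ u, (∀ j ∈ S, ν j u = 0) → f u = 0 := by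
  constructor
  · intro hf u hu
    induction hf using Submodule.span_induction with
    | mem x hx =>
      obtain ⟨j, hj, rfl⟩ := hx
      exact hu j hj
    | zero => rfl
    | add x y _ _ hx hy => rw [LinearMap.add_apply, hx, hy, add_zero]
    | smul a x _ hx => rw [LinearMap.smul_apply, hx, smul_zero]
  · intro h
    have := mem_span_of_iInf_ker_le_ker (L := fun j : S => ν j) (K := f) (by
      intro u hu
      simp only [Submodule.mem_iInf, LinearMap.mem_ker] at hu
      exact h u fun j hj => hu ⟨j, hj⟩)
    rwa [show Set.range (fun j : S => ν j) = ν '' S by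
      rw [Set.image_eq_range]; rfl] at this

theorem mem_inter_iff (A : HArr W n) (S : Finset (Fin n)) (x : W) :
    x ∈ A.inter S ↔ x ∈ A.amb ∧ ∀ i ∈ S, x ∈ A.H i := by
  rw [inter, AffineSubspace.mem_inf_iff]
  refine and_congr_right fun _ => ?_
  induction S using Finset.induction_on with
  | empty => simp
  | insert a S ha ih => simp [AffineSubspace.mem_inf_iff, ih]

theorem inter_anti (A : HArr W n) {S T : Finset (Fin n)} (h : S ⊆ T) : A.inter T ≤ A.inter S :=
  fun _ hx => (A.mem_inter_iff _ _).2
    ⟨((A.mem_inter_iff _ _).1 hx).1, fun i hi => ((A.mem_inter_iff _ _).1 hx).2 i (h hi)⟩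

theorem inter_ne_bot_anti (A : HArr W n) {S T : Finset (Fin n)} (h : S ⊆ T)
    (hT : A.inter T ≠ ⊥) : A.inter S ≠ ⊥ :=
  fun hS => hT (le_bot_iff.1 (hS ▸ A.inter_anti h))

theorem inter_ne_bot_iff (A : HArr W n) (S : Finset (Fin n)) :
    A.inter S ≠ ⊥ ↔ ∃ x, x ∈ A.inter S := by
  rw [← AffineSubspace.nonempty_iff_ne_bot]; rfl

theorem exists_equation [FiniteDimensional ℂ W] (A : HArr W n) (i : Fin n) :
    ∃ ν : Dual ℂ A.amb.direction, ν ≠ 0 ∧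
      ∀ x ∈ A.H i, ∀ v : A.amb.direction, (v : W) +ᵥ x ∈ A.H i ↔ ν v = 0 := by
  let K : Submodule ℂ A.amb.direction := (A.H i).direction.comap A.amb.direction.subtype
  have hle := AffineSubspace.direction_le (A.le_amb i)
  have hK : finrank ℂ K = finrank ℂ (A.H i).direction :=
    (Submodule.comapSubtypeEquivOfLe hle).finrank_eq
  have hh := A.hyp i
  have hlt : K < ⊤ := by
    refine lt_top_iff_ne_top.2 fun h => ?_
    rw [h, finrank_top] at hK
    omega
  obtain ⟨ν, hν, hker⟩ := Submodule.exists_le_ker_of_lt_top K hlt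
  have hk := Module.Dual.finrank_ker_add_one_of_ne_zero hν
  have heq : K = LinearMap.ker ν := Submodule.eq_of_le_of_finrank_eq hker (by omega)
  refine ⟨ν, hν, fun x hx v => ?_⟩
  rw [AffineSubspace.vadd_mem_iff_mem_direction _ hx, ← LinearMap.mem_ker, ← heq]
  rfl

/-- The linear forms defining the directions of the hyperplanes. -/
def nrm [FiniteDimensional ℂ W] (A : HArr W n) (i : Fin n) : Dual ℂ A.amb.direction :=
  (A.exists_equation i).choose

/-- The span of the normal covectors of a subarrangement. -/
def spn [FiniteDimensional ℂ W] (A : HArr W n) (S : Finset (Fin n)) :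
    Submodule ℂ (Dual ℂ A.amb.direction) := Submodule.span ℂ (A.nrm '' S)

section Normals

variable [FiniteDimensional ℂ W] (A : HArr W n)

theorem nrm_ne_zero (i : Fin n) : A.nrm i ≠ 0 := (A.exists_equation i).choose_spec.1

theorem vadd_mem_H_iff {i : Fin n} {x : W} (hx : x ∈ A.H i) (v : A.amb.direction) :
    (v : W) +ᵥ x ∈ A.H i ↔ A.nrm i v = 0 := (A.exists_equation i).choose_spec.2 x hx v

theorem mem_H_iff {i : Fin n} : ∀ x ∈ A.amb, ∃ c : ℂ, ∀ v : A.amb.direction,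
    (v : W) +ᵥ x ∈ A.H i ↔ A.nrm i v = c := by
  intro x hx
  obtain ⟨q, hq⟩ := A.nonemptyH i
  have hd : q -ᵥ x ∈ A.amb.direction :=
    AffineSubspace.vsub_mem_direction (A.le_amb i hq) hx
  refine ⟨A.nrm i ⟨q -ᵥ x, hd⟩, fun v => ?_⟩
  have h := A.vadd_mem_H_iff hq (v - ⟨q -ᵥ x, hd⟩)
  rw [map_sub, sub_eq_zero] at h
  rw [← h, show ((v - ⟨q -ᵥ x, hd⟩ : A.amb.direction) : W) +ᵥ q = (v : W) +ᵥ x by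
    simp only [Submodule.coe_sub, vsub_eq_sub, vadd_eq_add]
    abel]

theorem vadd_mem_inter_iff {S : Finset (Fin n)} {x : W} (hx : x ∈ A.inter S)
    (v : A.amb.direction) : (v : W) +ᵥ x ∈ A.inter S ↔ ∀ i ∈ S, A.nrm i v = 0 := by
  rw [mem_inter_iff] at hx ⊢
  rw [and_iff_right ((AffineSubspace.vadd_mem_iff_mem_direction _ hx.1).2 v.2)]
  exact forall₂_congr fun i hi => A.vadd_mem_H_iff (hx.2 i hi) v

theorem inter_le_H_iff {S : Finset (Fin n)} {i : Fin n} (h : A.inter (insert i S) ≠ ⊥) :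
    A.inter S ≤ A.H i ↔ A.nrm i ∈ A.spn S := by
  obtain ⟨x, hx⟩ := (A.inter_ne_bot_iff _).1 h
  have hxS := A.inter_anti (Finset.subset_insert i S) hx
  have hxi := ((A.mem_inter_iff _ _).1 hx).2 i (Finset.mem_insert_self _ _)
  have hxa := ((A.mem_inter_iff _ _).1 hx).1
  rw [spn, mem_span_dual_iff]
  constructor
  · intro hle u hu
    exact (A.vadd_mem_H_iff hxi u).1 (hle ((A.vadd_mem_inter_iff hxS u).2 hu))
  · intro hu y hy
    have hya := ((A.mem_inter_iff _ _).1 hy).1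
    have hd : y -ᵥ x ∈ A.amb.direction := AffineSubspace.vsub_mem_direction hya hxa
    have hv := A.vadd_mem_inter_iff hxS ⟨y -ᵥ x, hd⟩
    have hw := A.vadd_mem_H_iff hxi ⟨y -ᵥ x, hd⟩
    rw [vsub_vadd] at hv hw
    exact hw.2 (hu _ (hv.1 hy))

theorem cd_inter {S : Finset (Fin n)} (h : A.inter S ≠ ⊥) :
    A.cd (A.inter S) = finrank ℂ (A.spn S) := by
  obtain ⟨x, hx⟩ := (A.inter_ne_bot_iff _).1 h
  have h1 := Subspace.finrank_add_finrank_dualCoannihilator_eq (A.spn S)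
  have hle : (A.inter S).direction ≤ A.amb.direction :=
    AffineSubspace.direction_le inf_le_left
  have h2 : (A.spn S).dualCoannihilator =
      (A.inter S).direction.comap A.amb.direction.subtype := by
    ext v
    rw [Submodule.mem_comap, Submodule.subtype_apply,
      ← AffineSubspace.vadd_mem_iff_mem_direction _ hx, A.vadd_mem_inter_iff hx,
      Submodule.mem_dualCoannihilator]
    refine ⟨fun hφ i hi => hφ _ (Submodule.subset_span ⟨i, hi, rfl⟩), fun hi φ hφ => ?_⟩
    exact (mem_span_dual_iff _ _ _).1 hφ v hi
  rw [h2, (Submodule.comapSubtypeEquivOfLe hle).finrank_eq] at h1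
  rw [cd]
  omega

theorem inter_insert_ne_bot {S : Finset (Fin n)} {i : Fin n} (h : A.inter S ≠ ⊥)
    (hi : A.nrm i ∉ A.spn S) : A.inter (insert i S) ≠ ⊥ := by
  obtain ⟨x, hx⟩ := (A.inter_ne_bot_iff _).1 h
  rw [spn, mem_span_dual_iff] at hi
  push Not at hi
  obtain ⟨u, hu, hui⟩ := hi
  have hxa := ((A.mem_inter_iff _ _).1 hx).1
  obtain ⟨c, hc⟩ := A.mem_H_iff (i := i) x hxa
  have h1 := (hc ((c / A.nrm i u) • u)).2 (by
    rw [map_smul, smul_eq_mul, div_mul_cancel₀ _ hui])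
  have h2 := (A.vadd_mem_inter_iff hx ((c / A.nrm i u) • u)).2 (by
    intro j hj
    rw [map_smul, hu j hj, smul_zero])
  refine (A.inter_ne_bot_iff _).2 ⟨_, (A.mem_inter_iff _ _).2
    ⟨((A.mem_inter_iff _ _).1 h2).1, fun j hj => ?_⟩⟩
  obtain rfl | hj := Finset.mem_insert.1 hj
  · exact h1
  · exact ((A.mem_inter_iff _ _).1 h2).2 j hj

/-- Linear independence of the normal covectors. -/
def lin (S : Finset (Fin n)) : Prop := LinearIndepOn ℂ A.nrm (S : Set (Fin n))

theorem spn_mono {S T : Finset (Fin n)} (h : S ⊆ T) : A.spn S ≤ A.spn T :=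
  Submodule.span_mono (Set.image_mono (Finset.coe_subset.2 h))

theorem nrm_mem_spn {S : Finset (Fin n)} {i : Fin n} (h : i ∈ S) : A.nrm i ∈ A.spn S :=
  Submodule.subset_span ⟨i, h, rfl⟩

variable {A}

theorem lin.mono {S T : Finset (Fin n)} (hT : A.lin T) (h : S ⊆ T) : A.lin S :=
  LinearIndepOn.mono hT (Finset.coe_subset.2 h)

theorem lin_insert {S : Finset (Fin n)} {i : Fin n} (h : i ∉ S) :
    A.lin (insert i S) ↔ A.lin S ∧ A.nrm i ∉ A.spn S := by
  rw [lin, Finset.coe_insert, linearIndepOn_insert (by simpa using h)]; rfl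

theorem lin_empty : A.lin ∅ := by simp [lin]

theorem lin.inter_ne_bot {S : Finset (Fin n)} (h : A.lin S) : A.inter S ≠ ⊥ := by
  induction S using Finset.induction_on with
  | empty =>
    obtain ⟨x, hx⟩ := A.amb_ne
    exact (A.inter_ne_bot_iff _).2 ⟨x, (A.mem_inter_iff _ _).2 ⟨hx, by simp⟩⟩
  | insert a S ha ih =>
    rw [lin_insert ha] at h
    exact A.inter_insert_ne_bot (ih h.1) h.2

theorem lin_iff_finrank (S : Finset (Fin n)) : A.lin S ↔ finrank ℂ (A.spn S) = S.card := by
  rw [lin, LinearIndepOn, linearIndependent_iff_card_eq_finrank_span, Set.finrank,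
    show Set.range (fun j : (S : Set (Fin n)) => A.nrm j) = A.nrm '' S by
      rw [Set.image_eq_range], eq_comm]
  simp only [spn, Fintype.card_coe, Finset.coe_sort_coe]
  rfl

theorem finrank_spn_le (S : Finset (Fin n)) : finrank ℂ (A.spn S) ≤ S.card := by
  classical
  have := finrank_span_finset_le_card (R := ℂ) (S.image A.nrm)
  rw [Finset.coe_image] at this
  exact this.trans Finset.card_image_le

theorem indep_iff (S : Finset (Fin n)) : A.indep S ↔ A.lin S := by
  constructor
  · rintro ⟨h1, h2⟩
    rwa [lin_iff_finrank, ← A.cd_inter h1]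
  · intro h
    exact ⟨h.inter_ne_bot, by rw [A.cd_inter h.inter_ne_bot]; exact (lin_iff_finrank S).1 h⟩

theorem dep_iff (S : Finset (Fin n)) : A.dep S ↔ A.inter S ≠ ⊥ ∧ ¬ A.lin S := by
  rw [dep]
  refine and_congr_right fun h => ?_
  rw [A.cd_inter h, lin_iff_finrank]
  have := finrank_spn_le (A := A) S
  omega

theorem lin.insert_of_notMem {S : Finset (Fin n)} {i : Fin n} (hS : A.lin S)
    (h : A.nrm i ∉ A.spn S) : A.lin (insert i S) := by
  by_cases hi : i ∈ S
  · rwa [Finset.insert_eq_of_mem hi]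
  · exact (lin_insert hi).2 ⟨hS, h⟩

theorem spn_le {S : Finset (Fin n)} {P : Submodule ℂ (Dual ℂ A.amb.direction)}
    (h : ∀ i ∈ S, A.nrm i ∈ P) : A.spn S ≤ P := by
  refine Submodule.span_le.2 ?_
  rintro _ ⟨i, hi, rfl⟩
  exact h i hi

theorem exchange {S : Finset (Fin n)} {i j : Fin n} (h : A.nrm i ∈ A.spn (insert j S))
    (hi : A.nrm i ∉ A.spn S) : A.nrm j ∈ A.spn (insert i S) := by
  rw [spn, Finset.coe_insert, Set.image_insert_eq] at h ⊢
  exact mem_span_insert_exchange h hi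

/-- The augmentation property. -/
theorem lin.exists_augment {S T : Finset (Fin n)} (hS : A.lin S) (hT : A.lin T)
    (h : S.card < T.card) : ∃ i ∈ T, i ∉ S ∧ A.lin (insert i S) := by
  by_contra hcon
  push Not at hcon
  have hle : A.spn T ≤ A.spn S := by
    refine spn_le fun i hi => ?_
    by_contra hni
    exact hcon i hi (fun hiS => hni (A.nrm_mem_spn hiS)) (hS.insert_of_notMem hni)
  have := Submodule.finrank_mono hle
  rw [(lin_iff_finrank S).1 hS, (lin_iff_finrank T).1 hT] at this
  omega

theorem lin.card_le_rank {S : Finset (Fin n)} (h : A.lin S) : S.card ≤ A.rank := by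
  classical
  have := Finset.le_sup (f := fun S => if A.indep S then S.card else 0)
    (Finset.mem_powerset.2 (Finset.subset_univ S))
  simp only [(indep_iff S).2 h, if_true] at this
  unfold rank rankOn
  convert this

theorem exists_lin_card_eq_rank : ∃ S, A.lin S ∧ S.card = A.rank := by
  classical
  obtain ⟨S, -, hS⟩ := Finset.exists_mem_eq_sup _ (Finset.powerset_nonempty Finset.univ)
    (fun S => if A.indep S then S.card else 0)
  have hr : A.rank = if A.indep S then S.card else 0 := by
    rw [← hS]; unfold rank rankOn; congr!
  by_cases h : A.indep S
  · exact ⟨S, (indep_iff S).1 h, by rw [hr, if_pos h]⟩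
  · exact ⟨∅, lin_empty, by rw [hr, if_neg h]; rfl⟩

theorem isBase_iff (S : Finset (Fin n)) : A.isBase S ↔ A.lin S ∧ S.card = A.rank := by
  simp only [isBase, indep_iff]
  refine and_congr_right fun hS => ⟨fun h => ?_, fun h T hT hST => ?_⟩
  · by_contra hne
    obtain ⟨T, hT, hTr⟩ := exists_lin_card_eq_rank (A := A)
    obtain ⟨i, -, hiS, hi⟩ := hS.exists_augment hT (by have := hS.card_le_rank; omega)
    exact hiS (h _ hi (Finset.subset_insert i S) ▸ Finset.mem_insert_self i S)
  · exact Finset.eq_of_subset_of_card_le hST (by rw [h]; exact hT.card_le_rank)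

end Normals

/-! ### Sets without broken circuits -/

section Nbc

variable {A : HArr W n}

theorem exists_circuit {S : Finset (Fin n)} (h : A.dep S) : ∃ C ⊆ S, A.circuit C := by
  induction S using Finset.strongInduction with
  | H S ih =>
    by_cases hS : ∀ T ⊂ S, ¬ A.dep T
    · exact ⟨S, subset_rfl, h, hS⟩
    · push Not at hS
      obtain ⟨T, hTS, hT⟩ := hS
      obtain ⟨C, hC, hC'⟩ := ih T hTS hT
      exact ⟨C, hC.trans hTS.subset, hC'⟩

theorem nbcSet_mono {S T : Finset (Fin n)} (hT : A.nbcSet 1 T) (h : S ⊆ T) : A.nbcSet 1 S :=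
  ⟨A.inter_ne_bot_anti h hT.1, fun U hU => hT.2 U (hU.trans h)⟩

variable [FiniteDimensional ℂ W]

theorem circuit_ne_empty {C : Finset (Fin n)} (h : A.circuit C) : C.Nonempty := by
  rw [Finset.nonempty_iff_ne_empty]
  rintro rfl
  exact ((dep_iff _).1 h.1).2 lin_empty

theorem circuit_lin_erase {C : Finset (Fin n)} (h : A.circuit C) {i : Fin n} (hi : i ∈ C) :
    A.lin (C.erase i) := by
  have h1 := h.2 _ (Finset.erase_ssubset hi)
  rw [dep_iff, not_and_not_right] at h1
  exact h1 (A.inter_ne_bot_anti (Finset.erase_subset _ _) h.1.1)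

theorem circuit_mem_spn {C : Finset (Fin n)} (h : A.circuit C) {i : Fin n} (hi : i ∈ C) :
    A.nrm i ∈ A.spn (C.erase i) := by
  by_contra hni
  refine ((dep_iff _).1 h.1).2 ?_
  rw [← Finset.insert_erase hi]
  exact (circuit_lin_erase h hi).insert_of_notMem hni

theorem lin_of_nbcSet {S : Finset (Fin n)} (h : A.nbcSet 1 S) : A.lin S := by
  by_contra hS
  obtain ⟨C, hCS, hC⟩ := exists_circuit ((dep_iff S).2 ⟨h.1, hS⟩)
  have hne := circuit_ne_empty hC
  refine h.2 (C.erase (C.min' hne)) ((Finset.erase_subset _ _).trans hCS)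
    ⟨C.min' hne, Finset.notMem_erase _ _, fun j hj => ?_, ?_⟩
  · exact Finset.min'_lt_of_mem_erase_min' _ _ hj
  · rwa [Finset.insert_erase (Finset.min'_mem _ _)]

/-- No hyperplane smaller than all elements of an nbc set contains its intersection. -/
theorem not_lt_of_nbcSet {S : Finset (Fin n)} (h : A.nbcSet 1 S) {i : Fin n}
    (hi : A.inter S ≤ A.H i) (hlt : ∀ j ∈ S, i < j) : False := by
  have hiS : i ∉ S := fun hiS => (hlt i hiS).false
  have hne : A.inter (insert i S) ≠ ⊥ := by
    obtain ⟨x, hx⟩ := (A.inter_ne_bot_iff _).1 h.1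
    refine (A.inter_ne_bot_iff _).2 ⟨x, (A.mem_inter_iff _ _).2 ⟨?_, ?_⟩⟩
    · exact ((A.mem_inter_iff _ _).1 hx).1
    · intro j hj
      obtain rfl | hj := Finset.mem_insert.1 hj
      · exact hi hx
      · exact ((A.mem_inter_iff _ _).1 hx).2 j hj
  have hd : A.dep (insert i S) :=
    (dep_iff _).2 ⟨hne, fun hl => ((lin_insert hiS).1 hl).2 ((A.inter_le_H_iff hne).1 hi)⟩
  obtain ⟨C, hCS, hC⟩ := exists_circuit hd
  have hiC : i ∈ C := by
    by_contra hiC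
    exact ((dep_iff _).1 hC.1).2
      ((lin_of_nbcSet h).mono ((Finset.subset_insert_iff_of_notMem hiC).1 hCS))
  have hsub : C.erase i ⊆ S := Finset.subset_insert_iff.1 hCS
  refine h.2 (C.erase i) hsub ⟨i, Finset.notMem_erase _ _, fun j hj => hlt j (hsub hj), ?_⟩
  rwa [Finset.insert_erase hiC]

theorem nbcSet_insert {T : Finset (Fin n)} {j : Fin n} (hT : A.nbcSet 1 T)
    (hj : A.lin (insert j T)) (hjT : j ∉ T) (hmin : ∀ h < j, A.nrm h ∈ A.spn T) :
    A.nbcSet 1 (insert j T) := by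
  refine ⟨hj.inter_ne_bot, fun C hC => ?_⟩
  rintro ⟨h, hhC, hlt, hcirc⟩
  by_cases hjC : j ∈ C
  · have hhj : h < j := hlt j hjC
    refine ((lin_insert hjT).1 hj).2 (?_ : A.nrm j ∈ A.spn T)
    refine spn_le (P := A.spn T) (fun i hi => ?_)
      (circuit_mem_spn hcirc (Finset.mem_insert_of_mem hjC))
    obtain ⟨hij, hi⟩ := Finset.mem_erase.1 hi
    obtain rfl | hi := Finset.mem_insert.1 hi
    · exact hmin _ hhj
    · exact A.nrm_mem_spn (Finset.mem_of_mem_insert_of_ne (hC hi) hij)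
  · exact hT.2 C ((Finset.subset_insert_iff_of_notMem hjC).1 hC) ⟨h, hhC, hlt, hcirc⟩

theorem nbcBase_iff {S : Finset (Fin n)} :
    A.nbcBase 1 S ↔ A.nbcSet 1 S ∧ S.card = A.rank := by
  rw [nbcBase, isBase_iff]
  exact and_congr_right fun h => and_iff_right (lin_of_nbcSet h)

end Nbc

/-! ### The defining ideal of the Orlik–Solomon algebra -/

theorem osMk_eS_eq_zero {A : HArr W n} {S : Finset (Fin n)} (h : A.inter S = ⊥) :
    A.osMk (eS S) = 0 := by
  rw [osMk, RingQuot.mkAlgHom_rel ℂ (OSRel.isBot S h), map_zero]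

theorem osMk_bdry_eq_zero {A : HArr W n} {S : Finset (Fin n)} (h : A.dep S) :
    A.osMk (bdry S) = 0 := by
  rw [osMk, RingQuot.mkAlgHom_rel ℂ (OSRel.isDep S h), map_zero]

theorem osMk_eS_eq_zero_of_dep [FiniteDimensional ℂ W] {A : HArr W n} {S : Finset (Fin n)}
    (h : A.dep S) : A.osMk (eS S) = 0 := by
  have hne : S.Nonempty := by
    rw [Finset.nonempty_iff_ne_empty]
    rintro rfl
    exact ((dep_iff _).1 h).2 lin_empty
  obtain ⟨t, ht⟩ := hne
  have := ctr_gen_mul 1 t (eS S)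
  rw [gen_mul_eS_of_mem ht, map_zero, ← del, del_eS, Pi.one_apply, one_smul, eq_comm,
    sub_eq_zero] at this
  rw [this, map_mul, osMk_bdry_eq_zero h, mul_zero]

theorem bdry_mul_ι (S : Finset (Fin n)) (v : Fin n → ℂ) :
    bdry S * ExteriorAlgebra.ι ℂ v =
      (-1 : ℂ) ^ (S.card - 1) • (ExteriorAlgebra.ι ℂ v * bdry S) := by
  rw [bdry, Finset.sum_mul, Finset.mul_sum, Finset.smul_sum]
  refine Finset.sum_congr rfl fun i hi => ?_
  rw [smul_mul_assoc, eS_mul_ι, Finset.card_erase_of_mem hi, mul_smul_comm, smul_comm]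

/-- The left ideal generated by the Orlik–Solomon relations. -/
def osIdeal (A : HArr W n) : Ideal (ExteriorAlgebra ℂ (Fin n → ℂ)) :=
  Ideal.span {x | OSRel A x 0}

instance osIdeal_isTwoSided (A : HArr W n) : A.osIdeal.IsTwoSided where
  mul_mem_of_left := by
    intro a b
    induction b using ExteriorAlgebra.induction generalizing a with
    | algebraMap r =>
      intro ha
      rw [← Algebra.commutes]
      exact Ideal.mul_mem_left _ _ ha
    | ι v =>
      intro ha
      induction ha using Submodule.span_induction with
      | mem x hx =>
        have hx' : x ∈ A.osIdeal := Ideal.subset_span hx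
        have key : ∃ c : ℂ, x * ExteriorAlgebra.ι ℂ v = c • (ExteriorAlgebra.ι ℂ v * x) := by
          obtain ⟨S, _⟩ | ⟨S, _⟩ := hx
          · exact ⟨_, eS_mul_ι S v⟩
          · exact ⟨_, bdry_mul_ι S v⟩
        obtain ⟨c, hc⟩ := key
        rw [hc]
        exact Submodule.smul_of_tower_mem _ c (Ideal.mul_mem_left _ _ hx')
      | zero => simp
      | add x y _ _ hx hy =>
        rw [add_mul]
        exact add_mem hx hy
      | smul a x _ hx =>
        rw [smul_eq_mul, mul_assoc]
        exact Ideal.mul_mem_left _ _ hx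
    | mul b c hb hc =>
      intro ha
      rw [← mul_assoc]
      exact hc (hb ha)
    | add b c hb hc =>
      intro ha
      rw [mul_add]
      exact add_mem (hb ha) (hc ha)

theorem mem_osIdeal {A : HArr W n} {x : ExteriorAlgebra ℂ (Fin n → ℂ)} (h : A.osMk x = 0) :
    x ∈ A.osIdeal := by
  have hw : ∀ ⦃x y⦄, OSRel A x y →
      Ideal.Quotient.mkₐ ℂ A.osIdeal x = Ideal.Quotient.mkₐ ℂ A.osIdeal y := by
    intro x y hxy
    have hy : y = 0 := by cases hxy <;> rfl
    subst hy
    rw [map_zero]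
    exact Ideal.Quotient.eq_zero_iff_mem.2 (Ideal.subset_span hxy)
  have := congrArg (RingQuot.liftAlgHom ℂ ⟨Ideal.Quotient.mkₐ ℂ A.osIdeal, hw⟩) h
  rw [osMk, RingQuot.liftAlgHom_mkAlgHom_apply, map_zero] at this
  exact Ideal.Quotient.eq_zero_iff_mem.1 this

/-- A linear map on the exterior algebra factors through the Orlik–Solomon algebra as soon as it
kills the obvious relations. -/
theorem eq_zero_of_osMk_eq_zero {A : HArr W n} {M : Type*} [AddCommGroup M] [Module ℂ M]
    (f : ExteriorAlgebra ℂ (Fin n → ℂ) →ₗ[ℂ] M)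
    (h1 : ∀ S, A.inter S = ⊥ → f (eS S) = 0)
    (h2 : ∀ U T, A.dep T → f (eS U * bdry T) = 0)
    {x : ExteriorAlgebra ℂ (Fin n → ℂ)} (h : A.osMk x = 0) : f x = 0 := by
  suffices ∀ y, f (y * x) = 0 by simpa using this 1
  have hx := mem_osIdeal h
  clear h
  rw [osIdeal, Ideal.span] at hx
  induction hx using Submodule.span_induction with
  | mem x hx =>
    suffices f ∘ₗ LinearMap.mulRight ℂ x = 0 from fun y => congrArg (fun g => g y) this
    refine linearMap_ext_eS fun U => ?_
    change f (eS U * x) = 0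
    obtain ⟨S, hS⟩ | ⟨S, hS⟩ := hx
    · by_cases hd : Disjoint U S
      · obtain ⟨ε, -, he⟩ := eS_mul_eS_of_disjoint hd
        rw [he, map_smul, h1 _ (by
          by_contra hne
          exact A.inter_ne_bot_anti Finset.subset_union_right hne hS), smul_zero]
      · rw [eS_mul_eS_of_not_disjoint hd, map_zero]
    · exact h2 U S hS
  | zero => simp
  | add x y _ _ hx hy =>
    intro z
    rw [mul_add, map_add, hx, hy, add_zero]
  | smul a x _ hx =>
    intro y
    rw [smul_eq_mul, ← mul_assoc, hx]

open scoped Classical in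
/-- The projection of the exterior algebra onto the span of the monomials `e_S` with `q S`. -/
def prj (q : Finset (Fin n) → Prop) :
    ExteriorAlgebra ℂ (Fin n → ℂ) →ₗ[ℂ] ExteriorAlgebra ℂ (Fin n → ℂ) :=
  (monomialBasis n).constr ℂ fun S => if q S then eS S else 0

theorem prj_eS_pos {q : Finset (Fin n) → Prop} {S : Finset (Fin n)} (h : q S) :
    prj q (eS S) = eS S := by
  rw [prj, ← monomialBasis_apply, Basis.constr_basis, if_pos h, monomialBasis_apply]

theorem prj_eS_neg {q : Finset (Fin n) → Prop} {S : Finset (Fin n)} (h : ¬ q S) :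
    prj q (eS S) = 0 := by
  rw [prj, ← monomialBasis_apply, Basis.constr_basis, if_neg h]

/-- The map `∂ ∘ prj` descends to the Orlik–Solomon algebra for upwards closed conditions on
the intersections. -/
theorem osMk_del_prj_eq_zero [FiniteDimensional ℂ W] {A : HArr W n}
    {P : AffineSubspace ℂ W → Prop} (hP : ∀ X Y, X ≤ Y → P X → P Y) (hbot : ¬ P ⊥)
    {x : ExteriorAlgebra ℂ (Fin n → ℂ)} (h : A.osMk x = 0) :
    A.osMk (del (prj (fun S => P (A.inter S)) x)) = 0 := by
  refine eq_zero_of_osMk_eq_zero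
    (A.osMk.toLinearMap ∘ₗ del ∘ₗ prj (fun S => P (A.inter S))) ?_ ?_ h
  · intro S hS
    change A.osMk (del (prj _ (eS S))) = 0
    rw [prj_eS_neg (by rwa [hS]), map_zero, map_zero]
  · intro U T hT
    change A.osMk (del (prj _ (eS U * bdry T))) = 0
    by_cases hq : P (A.inter (U ∪ T))
    · have hfix : prj (fun S => P (A.inter S)) (eS U * bdry T) = eS U * bdry T := by
        rw [bdry, Finset.mul_sum, map_sum]
        refine Finset.sum_congr rfl fun t _ => ?_
        rw [mul_smul_comm, map_smul]
        congr 1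
        by_cases hd : Disjoint U (T.erase t)
        · obtain ⟨ε, -, he⟩ := eS_mul_eS_of_disjoint hd
          rw [he, map_smul, prj_eS_pos]
          exact hP _ _ (A.inter_anti
            (Finset.union_subset_union_right (Finset.erase_subset _ _))) hq
        · rw [eS_mul_eS_of_not_disjoint hd, map_zero]
      rw [hfix, ctr_eS_mul, ← del_eS T, ctr_ctr, mul_zero, smul_zero, add_zero, map_mul, del_eS,
        del_eS, osMk_bdry_eq_zero hT, mul_zero]
    · rw [bdry, Finset.mul_sum, map_sum, map_sum, map_sum]
      refine Finset.sum_eq_zero fun t ht => ?_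
      rw [mul_smul_comm, map_smul, map_smul, map_smul]
      suffices A.osMk (del (prj (fun S => P (A.inter S)) (eS U * eS (T.erase t)))) = 0 by
        rw [this, smul_zero]
      by_cases hd : Disjoint U (T.erase t)
      swap
      · rw [eS_mul_eS_of_not_disjoint hd, map_zero, map_zero, map_zero]
      obtain ⟨ε, hε, he⟩ := eS_mul_eS_of_disjoint hd
      by_cases hq' : P (A.inter (U ∪ T.erase t))
      swap
      · rw [he, map_smul, prj_eS_neg hq', smul_zero, map_zero, map_zero]
      have hdep : A.dep (T.erase t) := by
        have hT' := (dep_iff _).1 hT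
        refine (dep_iff _).2 ⟨A.inter_ne_bot_anti (Finset.erase_subset _ _) hT'.1, fun hl => ?_⟩
        have hmem : A.nrm t ∈ A.spn (T.erase t) := by
          by_contra hni
          refine hT'.2 ?_
          rw [← Finset.insert_erase ht]
          exact hl.insert_of_notMem hni
        have hle := (A.inter_le_H_iff (by rw [Finset.insert_erase ht]; exact hT'.1)).2 hmem
        refine hq (hP _ _ ?_ hq')
        intro y hy
        rw [mem_inter_iff] at hy ⊢
        refine ⟨hy.1, fun i hi => ?_⟩
        by_cases hit : i = t
        · rw [hit]
          refine hle ((A.mem_inter_iff _ _).2 ⟨hy.1, fun j hj => hy.2 j ?_⟩)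
          exact Finset.mem_union_right _ hj
        · refine hy.2 i ?_
          simp only [Finset.mem_union, Finset.mem_erase] at hi ⊢
          tauto
      have hfix : prj (fun S => P (A.inter S)) (eS U * eS (T.erase t)) =
          eS U * eS (T.erase t) := by
        rw [he, map_smul, prj_eS_pos hq']
      rw [hfix, ctr_eS_mul, map_add, map_mul, map_smul, map_mul, ← del, del_eS, del_eS,
        osMk_eS_eq_zero_of_dep hdep, osMk_bdry_eq_zero hdep]
      simp

/-! ### Functionals attached to flags -/

/-- The functional attached to a list of hyperplanes. -/
def flagFun (A : HArr W n) : List (Fin n) → Dual ℂ (ExteriorAlgebra ℂ (Fin n → ℂ))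
  | [] => (monomialBasis n).coord ∅
  | i :: l => flagFun A l ∘ₗ del ∘ₗ
      prj (fun S => A.inter (insert i l.toFinset) ≤ A.inter S)

/-- The product `ω_λ(X_1) ⋯ ω_λ(X_p)` attached to a list of hyperplanes. -/
def xiList (A : HArr W n) (lam : Fin n → ℂ) : List (Fin n) → OS A
  | [] => 1
  | i :: l => A.omLamX lam (A.inter (insert i l.toFinset)) * xiList A lam l

section FlagFun

variable {A : HArr W n}

theorem inter_le_amb (A : HArr W n) (S : Finset (Fin n)) : A.inter S ≤ A.amb := inf_le_left

theorem flagFun_nil_eS (S : Finset (Fin n)) : A.flagFun [] (eS S) = if S = ∅ then 1 else 0 := by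
  rw [flagFun, ← monomialBasis_apply, Basis.coord_apply, Basis.repr_self, Finsupp.single_apply]

theorem flagFun_cons_of_le {i : Fin n} {l : List (Fin n)} {S : Finset (Fin n)}
    (h : A.inter (insert i l.toFinset) ≤ A.inter S) :
    A.flagFun (i :: l) (eS S) = cob (fun T => A.flagFun l (eS T)) S := by
  rw [flagFun, LinearMap.comp_apply, LinearMap.comp_apply, prj_eS_pos h, del, ctr_eS, map_sum, cob]
  refine Finset.sum_congr rfl fun i _ => ?_
  rw [map_smul, Pi.one_apply, one_mul, smul_eq_mul]

theorem flagFun_cons_of_not_le {i : Fin n} {l : List (Fin n)} {S : Finset (Fin n)}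
    (h : ¬ A.inter (insert i l.toFinset) ≤ A.inter S) :
    A.flagFun (i :: l) (eS S) = 0 := by
  rw [flagFun, LinearMap.comp_apply, LinearMap.comp_apply, prj_eS_neg h, map_zero, map_zero]

theorem flagFun_support {l : List (Fin n)} {S : Finset (Fin n)} (h : A.flagFun l (eS S) ≠ 0) :
    A.inter l.toFinset ≤ A.inter S ∧ S.card = l.length := by
  induction l generalizing S with
  | nil =>
    rw [flagFun_nil_eS] at h
    obtain rfl : S = ∅ := by
      by_contra hS
      rw [if_neg hS] at h
      exact h rfl
    simp
  | cons i l ih =>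
    by_cases hle : A.inter (insert i l.toFinset) ≤ A.inter S
    · rw [flagFun_cons_of_le hle] at h
      obtain ⟨s, hs, hne⟩ := Finset.exists_ne_zero_of_sum_ne_zero h
      have hc := (ih (right_ne_zero_of_mul hne)).2
      rw [Finset.card_erase_of_mem hs] at hc
      have := Finset.card_pos.2 ⟨s, hs⟩
      exact ⟨by rwa [List.toFinset_cons], by rw [List.length_cons]; omega⟩
    · exact absurd (flagFun_cons_of_not_le hle) h

theorem le_inter_iff {X : AffineSubspace ℂ W} (hX : X ≤ A.amb) (S : Finset (Fin n)) :
    X ≤ A.inter S ↔ ∀ i ∈ S, i ∈ A.sub X := by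
  simp only [sub, Finset.mem_filter, Finset.mem_univ, true_and]
  refine ⟨fun h i hi x hx => ((A.mem_inter_iff _ _).1 (h hx)).2 i hi, fun h x hx => ?_⟩
  exact (A.mem_inter_iff _ _).2 ⟨hX hx, fun i hi => h i hi hx⟩

open scoped Classical in
theorem flagFun_cons_eq_ctr (i : Fin n) (l : List (Fin n)) :
    A.flagFun (i :: l) = A.flagFun l ∘ₗ
      ctr (fun j => if j ∈ A.sub (A.inter (insert i l.toFinset)) then 1 else 0) := by
  refine linearMap_ext_eS fun S => ?_
  by_cases hle : A.inter (insert i l.toFinset) ≤ A.inter S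
  · have h := (le_inter_iff (A.inter_le_amb _) S).1 hle
    rw [flagFun, LinearMap.comp_apply, LinearMap.comp_apply, LinearMap.comp_apply, prj_eS_pos hle,
      del_eS, ctr_eS_eq_bdry fun j hj => if_pos (h j hj)]
  · rw [flagFun_cons_of_not_le hle, LinearMap.comp_apply, ctr_eS, map_sum]
    refine (Finset.sum_eq_zero fun j hj => ?_).symm
    by_cases hjX : j ∈ A.sub (A.inter (insert i l.toFinset))
    · rw [if_pos hjX, map_smul, smul_eq_mul]
      by_contra hne
      have h1 := (flagFun_support (right_ne_zero_of_mul hne)).1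
      refine hle ((le_inter_iff (A.inter_le_amb _) S).2 fun k hk => ?_)
      by_cases hkj : k = j
      · rwa [hkj]
      · exact (le_inter_iff (A.inter_le_amb _) _).1
          ((A.inter_anti (Finset.subset_insert _ _)).trans h1) k (Finset.mem_erase.2 ⟨hkj, hk⟩)
    · rw [if_neg hjX, zero_mul, zero_smul, map_zero]

theorem osMk_dualForm_flagFun (lam : Fin n → ℂ) (l : List (Fin n)) :
    A.osMk (dualForm lam (A.flagFun l)) = A.xiList lam l := by
  induction l with
  | nil =>
    rw [dualForm_apply, Finset.sum_eq_single ∅ (fun S _ hS => ?_) (by simp), flagFun_nil_eS,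
      if_pos rfl, xiList]
    · simp
    · rw [flagFun_nil_eS, if_neg hS, mul_zero, zero_smul]
  | cons i l ih =>
    rw [flagFun_cons_eq_ctr, dualForm_comp_ctr, map_mul, ih, xiList, omLamX, map_sum]
    congr 1
    simp only [mul_ite, mul_one, mul_zero, ite_smul, zero_smul, apply_ite A.osMk, map_zero,
      map_smul]
    rw [← Finset.sum_filter]
    refine Finset.sum_congr ?_ fun j _ => rfl
    ext j
    simp

variable [FiniteDimensional ℂ W]

theorem flagFun_eq_zero {l : List (Fin n)} (hl : A.inter l.toFinset ≠ ⊥)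
    {x : ExteriorAlgebra ℂ (Fin n → ℂ)} (h : A.osMk x = 0) : A.flagFun l x = 0 := by
  induction l generalizing x with
  | nil =>
    refine eq_zero_of_osMk_eq_zero _ (fun S hS => ?_) (fun U T hT => ?_) h
    · rw [flagFun_nil_eS, if_neg]
      rintro rfl
      exact hl hS
    · rw [bdry, Finset.mul_sum, map_sum]
      refine Finset.sum_eq_zero fun t ht => ?_
      rw [mul_smul_comm, map_smul]
      by_cases hd : Disjoint U (T.erase t)
      · obtain ⟨ε, -, he⟩ := eS_mul_eS_of_disjoint hd
        rw [he, map_smul, flagFun_nil_eS, if_neg, smul_zero, smul_zero]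
        intro hempty
        have hTt : T.erase t = ∅ :=
          Finset.subset_empty.1 (hempty ▸ Finset.subset_union_right)
        refine ((dep_iff _).1 hT).2 ?_
        rw [← Finset.insert_erase ht, hTt]
        refine lin_empty.insert_of_notMem ?_
        simpa [spn] using A.nrm_ne_zero t
      · rw [eS_mul_eS_of_not_disjoint hd, map_zero, smul_zero]
  | cons i l ih =>
    rw [List.toFinset_cons] at hl
    refine ih (A.inter_ne_bot_anti (Finset.subset_insert _ _) hl) ?_
    exact osMk_del_prj_eq_zero (P := fun X => A.inter (insert i l.toFinset) ≤ X)
      (fun X Y hXY hX => hX.trans hXY) (fun hb => hl (le_bot_iff.1 hb)) h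

theorem spn_eq_of_inter_le {S T : Finset (Fin n)} (hT : A.inter T ≠ ⊥)
    (hle : A.inter T ≤ A.inter S) : A.spn S ≤ A.spn T := by
  refine spn_le fun i hi => ?_
  have hi' : A.inter T ≤ A.H i := fun x hx => ((A.mem_inter_iff _ _).1 (hle hx)).2 i hi
  refine (A.inter_le_H_iff fun hb => hT (le_bot_iff.1 ?_)).1 hi'
  rw [← hb]
  refine fun x hx => (A.mem_inter_iff _ _).2 ⟨((A.mem_inter_iff _ _).1 hx).1, fun j hj => ?_⟩
  obtain rfl | hj := Finset.mem_insert.1 hj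
  · exact hi' hx
  · exact ((A.mem_inter_iff _ _).1 hx).2 j hj

/-- An inclusion of intersections of independent sets of the same size is an equality. -/
theorem inter_eq_of_le {S T : Finset (Fin n)} (hS : A.lin S) (hT : A.lin T)
    (hcard : S.card = T.card) (hle : A.inter T ≤ A.inter S) : A.inter T = A.inter S := by
  refine le_antisymm hle ((le_inter_iff (A.inter_le_amb _) T).2 fun i hi => ?_)
  have h1 : A.spn S = A.spn T := by
    refine Submodule.eq_of_le_of_finrank_eq (spn_eq_of_inter_le hT.inter_ne_bot hle) ?_
    rw [(lin_iff_finrank S).1 hS, (lin_iff_finrank T).1 hT, hcard]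
  simp only [sub, Finset.mem_filter, Finset.mem_univ, true_and]
  rw [A.inter_le_H_iff, h1]
  · exact A.nrm_mem_spn hi
  · intro hb
    refine hT.inter_ne_bot (le_bot_iff.1 (hb ▸ ?_))
    refine (le_inter_iff (A.inter_le_amb _) _).2 fun j hj => ?_
    obtain rfl | hj := Finset.mem_insert.1 hj
    · exact (le_inter_iff (A.inter_le_amb _) _).1 le_rfl _ hi
    · exact (le_inter_iff (A.inter_le_amb _) _).1 hle _ hj

open scoped Classical in
theorem flagFun_nbcSet {l : List (Fin n)} (hl : l.SortedLT) (hB : A.nbcSet 1 l.toFinset)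
    {S : Finset (Fin n)} (hS : A.nbcSet 1 S) (hcard : S.card = l.length) :
    A.flagFun l (eS S) = if S = l.toFinset then 1 else 0 := by
  induction l generalizing S with
  | nil =>
    rw [flagFun_nil_eS, List.toFinset_nil]
  | cons i l ih =>
    rw [List.toFinset_cons] at hB ⊢
    have hlt : ∀ j ∈ l.toFinset, i < j := by
      intro j hj
      exact (List.pairwise_cons.1 hl.pairwise).1 j (List.mem_toFinset.1 hj)
    have hil : i ∉ l.toFinset := fun h => (hlt i h).false
    have hl' : l.SortedLT := (List.pairwise_cons.1 hl.pairwise).2.sortedLT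
    have hBl := nbcSet_mono hB (Finset.subset_insert i l.toFinset)
    by_cases hle : A.inter (insert i l.toFinset) ≤ A.inter S
    swap
    · rw [flagFun_cons_of_not_le hle, if_neg]
      rintro rfl
      exact hle le_rfl
    have hterm : ∀ s ∈ S, A.flagFun l (eS (S.erase s)) =
        if S.erase s = l.toFinset then 1 else 0 := by
      intro s hs
      refine ih hl' hBl (nbcSet_mono hS (Finset.erase_subset _ _)) ?_
      rw [Finset.card_erase_of_mem hs, hcard]
      simp
    have hmin : ∀ s ∈ S, S.erase s = l.toFinset → s = i := by
      intro s hs hsl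
      have hlc : (insert i l.toFinset).card = l.length + 1 := by
        rw [Finset.card_insert_of_notMem hil, List.toFinset_card_of_nodup hl'.nodup]
      have heq := inter_eq_of_le (lin_of_nbcSet hS) (lin_of_nbcSet hB)
        (by rw [hlc, hcard]; simp) hle
      refine le_antisymm ?_ ?_ <;> by_contra! hlt'
      · refine not_lt_of_nbcSet hS (i := i) ?_ fun j hj => ?_
        · rw [← heq]
          exact fun x hx => ((A.mem_inter_iff _ _).1 hx).2 i (Finset.mem_insert_self _ _)
        · by_cases hjs : j = s
          · rwa [hjs]
          · exact hlt j (hsl ▸ Finset.mem_erase.2 ⟨hjs, hj⟩)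
      · refine not_lt_of_nbcSet hB (i := s) ?_ fun j hj => ?_
        · rw [heq]
          exact fun x hx => ((A.mem_inter_iff _ _).1 hx).2 s hs
        · obtain rfl | hj := Finset.mem_insert.1 hj
          · exact hlt'
          · exact hlt'.trans (hlt j hj)
    rw [flagFun_cons_of_le hle, cob]
    split_ifs with hSB
    · subst hSB
      rw [Finset.sum_eq_single i, hterm i (Finset.mem_insert_self _ _), Finset.erase_insert hil,
        if_pos rfl, mul_one, sg_insert_self, sg_eq_one fun j hj => (hlt j hj).le]
      · intro s hs hsi
        rw [hterm s hs, if_neg fun h => hsi (hmin s hs h), mul_zero]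
      · exact fun h => absurd (Finset.mem_insert_self _ _) h
    · refine Finset.sum_eq_zero fun s hs => ?_
      rw [hterm s hs, if_neg, mul_zero]
      intro h
      apply hSB
      rw [← h, ← hmin s hs h, Finset.insert_erase hs]

end FlagFun

/-! ### The forms attached to nbc sets span -/

section Spanning

variable {A : HArr W n}

open scoped Classical in
/-- The nbc sets of cardinality `p`. -/
def nbcF (A : HArr W n) (p : ℕ) : Finset (Finset (Fin n)) :=
  Finset.univ.filter fun B => A.nbcSet 1 B ∧ B.card = p

theorem mem_nbcF {p : ℕ} {B : Finset (Fin n)} : B ∈ A.nbcF p ↔ A.nbcSet 1 B ∧ B.card = p := by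
  simp [nbcF]

theorem omB_mem_span_nbcF (S : Finset (Fin n)) :
    A.omB S ∈ Submodule.span ℂ (A.omB '' (A.nbcF S.card : Set (Finset (Fin n)))) := by
  induction hw : ∑ i ∈ S, (i : ℕ) using Nat.strong_induction_on generalizing S with
  | _ w ih =>
  by_cases hS : A.inter S = ⊥
  · rw [omB, osMk_eS_eq_zero hS]
    exact zero_mem _
  by_cases hnbc : A.nbcSet 1 S
  · exact Submodule.subset_span ⟨S, mem_nbcF.2 ⟨hnbc, rfl⟩, rfl⟩
  obtain ⟨T, hTS, h, hhT, hlt, hcirc⟩ : ∃ T ⊆ S, A.brokenCircuit 1 T := by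
    by_contra! hcon
    exact hnbc ⟨hS, hcon⟩
  have hd : Disjoint (S \ T) T := Finset.sdiff_disjoint
  obtain ⟨ε, hε, he⟩ := eS_mul_eS_of_disjoint hd
  rw [Finset.sdiff_union_of_subset hTS] at he
  have hrel : A.osMk (eS (S \ T) * bdry (insert h T)) = 0 := by
    rw [map_mul, osMk_bdry_eq_zero hcirc.1, mul_zero]
  rw [bdry, Finset.sum_insert hhT, Finset.erase_insert hhT, mul_add, mul_smul_comm, he, map_add,
    map_smul, map_smul, smul_smul] at hrel
  have hc : (-1 : ℂ) ^ (Finset.filter (fun j => j < h) (insert h T)).card * ε ≠ 0 :=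
    mul_ne_zero (pow_ne_zero _ (by simp)) hε
  rw [← Submodule.smul_mem_iff _ hc, omB, eq_neg_of_add_eq_zero_left hrel, neg_mem_iff,
    Finset.mul_sum, map_sum]
  refine Submodule.sum_mem _ fun t ht => ?_
  rw [mul_smul_comm, map_smul]
  refine Submodule.smul_mem _ _ ?_
  by_cases hd' : Disjoint (S \ T) ((insert h T).erase t)
  swap
  · rw [eS_mul_eS_of_not_disjoint hd', map_zero]
    exact zero_mem _
  obtain ⟨ε', -, he'⟩ := eS_mul_eS_of_disjoint hd'
  rw [he', map_smul]
  refine Submodule.smul_mem _ _ ?_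
  have ht' : t ∈ insert h T := Finset.mem_insert_of_mem ht
  have hcard : (S \ T ∪ (insert h T).erase t).card = S.card := by
    rw [Finset.card_union_of_disjoint hd', Finset.card_erase_of_mem ht',
      Finset.card_insert_of_notMem hhT, Nat.add_sub_cancel,
      ← Finset.card_union_of_disjoint hd, Finset.sdiff_union_of_subset hTS]
  rw [← hcard]
  refine ih _ ?_ _ rfl
  have h1 := Finset.sum_union hd' (f := fun i : Fin n => (i : ℕ))
  have h2 := Finset.sum_sdiff hTS (f := fun i : Fin n => (i : ℕ))
  have h3 := Finset.add_sum_erase _ (fun i : Fin n => (i : ℕ)) ht'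
  rw [Finset.sum_insert hhT] at h3
  have h4 : (h : ℕ) < t := hlt t ht
  omega

/-- The functional attached to the standard ordering of a set. -/
def setFun (A : HArr W n) (S : Finset (Fin n)) : Dual ℂ (ExteriorAlgebra ℂ (Fin n → ℂ)) :=
  A.flagFun (S.sort (· ≤ ·))

/-- The form attached to the standard ordering of a set. -/
def xiSet (A : HArr W n) (lam : Fin n → ℂ) (S : Finset (Fin n)) : OS A :=
  A.xiList lam (S.sort (· ≤ ·))

theorem setFun_support {B S : Finset (Fin n)} (h : A.setFun B (eS S) ≠ 0) : S.card = B.card := by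
  rw [(flagFun_support h).2, Finset.length_sort]

theorem eq_zero_of_nbcF {p : ℕ} {φ : Dual ℂ (ExteriorAlgebra ℂ (Fin n → ℂ))}
    (h1 : ∀ x, A.osMk x = 0 → φ x = 0) (h2 : ∀ S, φ (eS S) ≠ 0 → S.card = p)
    (h3 : ∀ B ∈ A.nbcF p, φ (eS B) = 0) : φ = 0 := by
  refine linearMap_ext_eS fun S => ?_
  rw [LinearMap.zero_apply]
  by_contra hne
  have hp := h2 S hne
  have hmem := omB_mem_span_nbcF (A := A) S
  rw [hp, show A.omB '' (A.nbcF p : Set (Finset (Fin n))) =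
    A.osMk.toLinearMap '' (eS '' (A.nbcF p : Set (Finset (Fin n)))) by
      rw [Set.image_image]; rfl, ← Submodule.map_span] at hmem
  obtain ⟨y, hy, hyS⟩ := hmem
  have hφy : φ y = 0 := by
    refine (Submodule.span_le (p := LinearMap.ker φ)).2 ?_ hy
    rintro _ ⟨B, hB, rfl⟩
    exact h3 B hB
  have := h1 (eS S - y) (by
    rw [map_sub, sub_eq_zero]
    exact hyS.symm)
  rw [map_sub, hφy, sub_zero] at this
  exact hne this

variable [FiniteDimensional ℂ W]

theorem setFun_eq_zero {B : Finset (Fin n)} (hB : A.inter B ≠ ⊥)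
    {x : ExteriorAlgebra ℂ (Fin n → ℂ)} (h : A.osMk x = 0) : A.setFun B x = 0 :=
  flagFun_eq_zero (by rwa [Finset.sort_toFinset]) h

open scoped Classical in
theorem setFun_nbcF {p : ℕ} {B S : Finset (Fin n)} (hB : B ∈ A.nbcF p) (hS : S ∈ A.nbcF p) :
    A.setFun B (eS S) = if S = B then 1 else 0 := by
  rw [mem_nbcF] at hB hS
  rw [setFun, flagFun_nbcSet (Finset.sortedLT_sort B) (by rw [Finset.sort_toFinset]; exact hB.1)
    hS.1 (by rw [Finset.length_sort, hB.2, hS.2]), Finset.sort_toFinset]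

/-- The form of a functional on the Orlik–Solomon algebra in terms of the forms of nbc sets. -/
theorem osMk_dualForm_eq (lam : Fin n → ℂ) {p : ℕ}
    {φ : Dual ℂ (ExteriorAlgebra ℂ (Fin n → ℂ))}
    (h1 : ∀ x, A.osMk x = 0 → φ x = 0) (h2 : ∀ S, φ (eS S) ≠ 0 → S.card = p) :
    A.osMk (dualForm lam φ) = ∑ B ∈ A.nbcF p, φ (eS B) • A.xiSet lam B := by
  classical
  have key : φ - ∑ B ∈ A.nbcF p, φ (eS B) • A.setFun B = 0 := by
    refine eq_zero_of_nbcF (A := A) (p := p) (fun x hx => ?_) (fun S hS => ?_) (fun B hB => ?_)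
    · simp only [LinearMap.sub_apply, LinearMap.sum_apply, LinearMap.smul_apply, h1 x hx]
      rw [Finset.sum_eq_zero, sub_zero]
      intro B hB
      rw [setFun_eq_zero (mem_nbcF.1 hB).1.1 hx, smul_zero]
    · by_contra hp
      refine hS ?_
      simp only [LinearMap.sub_apply, LinearMap.sum_apply, LinearMap.smul_apply]
      rw [not_ne_iff.1 (mt (h2 S) hp), Finset.sum_eq_zero, sub_zero]
      intro B hB
      rw [not_ne_iff.1 (mt setFun_support fun h => hp (h.trans (mem_nbcF.1 hB).2)), smul_zero]
    · simp only [LinearMap.sub_apply, LinearMap.sum_apply, LinearMap.smul_apply]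
      rw [Finset.sum_eq_single B, setFun_nbcF hB hB, if_pos rfl, smul_eq_mul, mul_one, sub_self]
      · intro B' hB' hne
        rw [setFun_nbcF hB' hB, if_neg hne.symm, smul_zero]
      · exact fun h => absurd hB h
  conv_lhs => rw [sub_eq_zero.1 key, map_sum, map_sum]
  refine Finset.sum_congr rfl fun B hB => ?_
  rw [map_smul, map_smul, setFun, osMk_dualForm_flagFun, xiSet]

theorem xiList_mem_span (lam : Fin n → ℂ) {l : List (Fin n)} (hl : A.inter l.toFinset ≠ ⊥) :
    A.xiList lam l ∈
      Submodule.span ℂ (A.xiSet lam '' (A.nbcF l.length : Set (Finset (Fin n)))) := by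
  rw [← osMk_dualForm_flagFun, osMk_dualForm_eq lam (p := l.length)
    (fun x hx => flagFun_eq_zero hl hx) (fun S hS => (flagFun_support hS).2)]
  exact Submodule.sum_mem _ fun B hB =>
    Submodule.smul_mem _ _ (Submodule.subset_span ⟨B, hB, rfl⟩)

end Spanning

/-! ### Dense edges -/

section Dense

variable {A : HArr W n}

theorem inter_sub_of_inter (S : Finset (Fin n)) : A.inter (A.sub (A.inter S)) = A.inter S := by
  refine le_antisymm (A.inter_anti fun i hi => ?_) ?_
  · exact (le_inter_iff (A.inter_le_amb _) S).1 le_rfl i hi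
  · exact (le_inter_iff (A.inter_le_amb _) _).2 fun i hi => hi

variable [FiniteDimensional ℂ W]

theorem finrank_spn_union_le (S T : Finset (Fin n)) :
    finrank ℂ (A.spn (S ∪ T)) ≤ finrank ℂ (A.spn S) + finrank ℂ (A.spn T) := by
  have h : A.spn (S ∪ T) ≤ A.spn S ⊔ A.spn T := spn_le fun i hi => by
    obtain hi | hi := Finset.mem_union.1 hi
    · exact Submodule.mem_sup_left (A.nrm_mem_spn hi)
    · exact Submodule.mem_sup_right (A.nrm_mem_spn hi)
  exact (Submodule.finrank_mono h).trans (Submodule.finrank_add_le_finrank_add_finrank _ _)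

theorem spn_union (S T : Finset (Fin n)) : A.spn (S ∪ T) = A.spn S ⊔ A.spn T :=
  le_antisymm (spn_le fun i hi => by
      obtain hi | hi := Finset.mem_union.1 hi
      · exact Submodule.mem_sup_left (A.nrm_mem_spn hi)
      · exact Submodule.mem_sup_right (A.nrm_mem_spn hi))
    (sup_le (A.spn_mono Finset.subset_union_left) (A.spn_mono Finset.subset_union_right))

/-- Every edge has a dense factor. -/
theorem exists_dense_factor {S : Finset (Fin n)} (hS : A.inter S ≠ ⊥) (hne : S.Nonempty) :
    ∃ C ⊆ A.sub (A.inter S), A.memL (A.inter C) ∧ A.inter C ≠ A.amb ∧ A.denseL (A.inter C) ∧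
      A.sub (A.inter C) = C ∧
      finrank ℂ (A.spn C) + finrank ℂ (A.spn (A.sub (A.inter S) \ C)) =
        finrank ℂ (A.spn (A.sub (A.inter S))) := by
  classical
  set X := A.inter S with hX
  have hcen : A.inter (A.sub X) ≠ ⊥ := by rwa [hX, inter_sub_of_inter]
  let F := (A.sub X).powerset.filter fun C => C.Nonempty ∧
    finrank ℂ (A.spn C) + finrank ℂ (A.spn (A.sub X \ C)) = finrank ℂ (A.spn (A.sub X))
  have hF : F.Nonempty := by
    refine ⟨A.sub X, ?_⟩
    obtain ⟨s, hs⟩ := hne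
    simp only [F, Finset.mem_filter, Finset.mem_powerset, subset_rfl, true_and]
    refine ⟨⟨s, (le_inter_iff (A.inter_le_amb _) S).1 le_rfl s hs⟩, ?_⟩
    rw [Finset.sdiff_self, spn, spn, Finset.coe_empty, Set.image_empty, Submodule.span_empty,
      finrank_bot, add_zero]
  obtain ⟨C, hCF, hmin⟩ := Finset.exists_min_image F Finset.card hF
  have hCF' := hCF
  simp only [F, Finset.mem_filter, Finset.mem_powerset] at hCF
  obtain ⟨hCX, hCne, hrk⟩ := hCF
  have hCcen := A.inter_ne_bot_anti hCX hcen
  have hsubX : A.sub (A.inter C) ⊆ A.sub X := by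
    intro i hi
    simp only [sub, Finset.mem_filter, Finset.mem_univ, true_and] at hi ⊢
    refine le_trans ?_ hi
    exact (le_inter_iff (A.inter_le_amb _) C).2 fun j hj => hCX hj
  have hdis : A.spn C ⊓ A.spn (A.sub X \ C) = ⊥ := by
    have h := Submodule.finrank_sup_add_finrank_inf_eq (A.spn C) (A.spn (A.sub X \ C))
    rw [← spn_union, Finset.union_sdiff_of_subset hCX, hrk] at h
    exact Submodule.finrank_eq_zero.1 (by omega)
  have hsub : A.sub (A.inter C) = C := by
    refine Finset.Subset.antisymm (fun i hi => ?_)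
      (fun i hi => (le_inter_iff (A.inter_le_amb _) C).1 le_rfl i hi)
    by_contra hiC
    have hiX := hsubX hi
    have h1 : A.nrm i ∈ A.spn C := by
      refine (A.inter_le_H_iff (A.inter_ne_bot_anti ?_ hcen)).1 ?_
      · exact Finset.insert_subset hiX hCX
      · simpa [sub] using hi
    have h2 : A.nrm i ∈ A.spn (A.sub X \ C) :=
      A.nrm_mem_spn (Finset.mem_sdiff.2 ⟨hiX, hiC⟩)
    have h3 : A.nrm i ∈ A.spn C ⊓ A.spn (A.sub X \ C) := ⟨h1, h2⟩
    rw [hdis, Submodule.mem_bot] at h3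
    exact A.nrm_ne_zero i h3
  refine ⟨C, hCX, ⟨hCcen, C, rfl⟩, fun hamb => ?_, ?_, hsub, hrk⟩
  · obtain ⟨i, hi⟩ := hCne
    have h1 : A.inter ∅ ≤ A.H i := by
      refine (A.inter_le_amb _).trans ?_
      rw [← hamb]
      exact fun x hx => ((A.mem_inter_iff _ _).1 hx).2 i hi
    have h2 := (A.inter_le_H_iff
      (A.inter_ne_bot_anti (Finset.insert_subset hi (Finset.empty_subset _)) hCcen)).1 h1
    rw [spn, Finset.coe_empty, Set.image_empty, Submodule.span_empty, Submodule.mem_bot] at h2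
    exact A.nrm_ne_zero i h2
  · rintro ⟨P, Q, hPQ, hP, hQ, hun, hcd⟩
    rw [hsub] at hun
    have hPC : P ⊆ C := hun ▸ Finset.subset_union_left
    have hQC : Q ⊆ C := hun ▸ Finset.subset_union_right
    rw [A.cd_inter (A.inter_ne_bot_anti hPC hCcen), A.cd_inter (A.inter_ne_bot_anti hQC hCcen),
      A.cd_inter hCcen] at hcd
    have hdiff : A.sub X \ P ⊆ Q ∪ (A.sub X \ C) := by
      intro i hi
      rw [Finset.mem_sdiff] at hi
      rw [Finset.mem_union, Finset.mem_sdiff]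
      by_cases hiC : i ∈ C
      · rw [← hun, Finset.mem_union] at hiC
        exact Or.inl (hiC.resolve_left hi.2)
      · exact Or.inr ⟨hi.1, hiC⟩
    have h1 := (Submodule.finrank_mono (A.spn_mono hdiff)).trans (finrank_spn_union_le _ _)
    have h2 := finrank_spn_union_le (A := A) P (A.sub X \ P)
    rw [Finset.union_sdiff_of_subset (hPC.trans hCX)] at h2
    have hPF : P ∈ F := by
      simp only [F, Finset.mem_filter, Finset.mem_powerset]
      exact ⟨hPC.trans hCX, hP, by omega⟩
    have h3 := hmin P hPF
    rw [← hun, Finset.card_union_of_disjoint hPQ] at h3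
    have := Finset.card_pos.2 hQ
    omega

open scoped Classical in
theorem osMk_ctr_eq_zero {X : AffineSubspace ℂ W} (hX : A.inter (A.sub X) ≠ ⊥)
    {S C : Finset (Fin n)}
    (hrk : finrank ℂ (A.spn C) + finrank ℂ (A.spn (A.sub X \ C)) =
      finrank ℂ (A.spn (A.sub X)))
    (hS : S ⊆ A.sub X) (hdep : ¬ finrank ℂ (A.spn (A.sub X)) ≥ S.card) :
    A.osMk (ctr (fun j => if j ∈ C then 1 else 0) (eS S)) = 0 := by
  have hd : Disjoint (S \ C) (S ∩ C) := Finset.disjoint_sdiff_inter S C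
  obtain ⟨ε, hε, he⟩ := eS_mul_eS_of_disjoint hd
  rw [Finset.sdiff_union_inter] at he
  have hzero : A.osMk (eS (S \ C)) * A.osMk (bdry (S ∩ C)) = 0 := by
    by_cases h1 : A.lin (S ∩ C)
    · by_cases h2 : A.lin (S \ C)
      · refine absurd ?_ hdep
        rw [lin_iff_finrank] at h1 h2
        have h3 := Submodule.finrank_mono (A.spn_mono (Finset.inter_subset_right (s₁ := S) (s₂ := C)))
        have h4 := Submodule.finrank_mono (A.spn_mono
          (Finset.sdiff_subset_sdiff hS (subset_refl C)))
        have h5 := Finset.card_union_of_disjoint hd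
        rw [Finset.sdiff_union_inter] at h5
        omega
      · rw [osMk_eS_eq_zero_of_dep, zero_mul]
        exact (dep_iff _).2
          ⟨A.inter_ne_bot_anti (Finset.sdiff_subset.trans hS) hX, h2⟩
    · rw [osMk_bdry_eq_zero, mul_zero]
      exact (dep_iff _).2 ⟨A.inter_ne_bot_anti (Finset.inter_subset_left.trans hS) hX, h1⟩
  have h := ctr_eS_mul (fun j => if j ∈ C then (1 : ℂ) else 0) (S \ C) (eS (S ∩ C))
  rw [he, map_smul, ctr_eS_eq_zero fun i hi => if_neg (Finset.mem_sdiff.1 hi).2, zero_mul,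
    zero_add, ctr_eS_eq_bdry fun i hi => if_pos (Finset.mem_inter.1 hi).2] at h
  have h' := congrArg A.osMk h
  rw [map_smul, map_smul, map_mul, hzero, smul_zero] at h'
  exact (smul_eq_zero.1 h').resolve_left hε

theorem omB_mem_span_xiList {lam : Fin n → ℂ}
    (hlam : ∀ X, A.memL X → X ≠ A.amb → A.denseL X → A.lamX lam X ≠ 0)
    {S : Finset (Fin n)} (hS : A.lin S) :
    A.omB S ∈ Submodule.span ℂ
      (A.xiList lam '' {l | A.inter l.toFinset = A.inter S ∧ l.length = S.card}) := by
  classical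
  induction hk : S.card generalizing S with
  | zero =>
    obtain rfl := Finset.card_eq_zero.1 hk
    refine Submodule.subset_span ⟨[], ⟨by simp, by simp⟩, ?_⟩
    rw [xiList, omB, eS_empty, map_one]
  | succ k ih =>
    have hne : S.Nonempty := Finset.card_pos.1 (by omega)
    obtain ⟨C, hCX, hmem, hamb, hdense, hsub, hrk⟩ := exists_dense_factor hS.inter_ne_bot hne
    have hL := hlam _ hmem hamb hdense
    set X := A.inter S with hX
    have hcen : A.inter (A.sub X) ≠ ⊥ := by rw [hX, inter_sub_of_inter]; exact hS.inter_ne_bot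
    have hSX : S ⊆ A.sub X := (le_inter_iff (A.inter_le_amb _) S).1 le_rfl
    have hrkX : finrank ℂ (A.spn (A.sub X)) = S.card := by
      rw [← A.cd_inter hcen, inter_sub_of_inter, A.cd_inter hS.inter_ne_bot]
      exact (lin_iff_finrank S).1 hS
    let d : Fin n → ℂ := fun j => if j ∈ C then 1 else 0
    have hstep : ∀ i ∈ A.sub X, A.om i * A.osMk (ctr d (eS S)) = d i • A.omB S := by
      intro i hi
      have h0 : A.osMk (ctr d (gen i * eS S)) = 0 := by
        by_cases hiS : i ∈ S
        · rw [gen_mul_eS_of_mem hiS, map_zero, map_zero]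
        · rw [gen_mul_eS hiS, map_smul, map_smul, osMk_ctr_eq_zero hcen hrk, smul_zero]
          · exact Finset.insert_subset hi hSX
          · rw [hrkX, Finset.card_insert_of_notMem hiS]
            omega
      rw [ctr_gen_mul, map_sub, map_smul, map_mul, sub_eq_zero] at h0
      exact h0.symm
    have hmain : A.omLamX lam X * A.osMk (ctr d (eS S)) = A.lamX lam (A.inter C) • A.omB S := by
      rw [omLamX, Finset.sum_mul, lamX, hsub, Finset.sum_smul,
        ← Finset.sum_subset hCX]
      · refine Finset.sum_congr rfl fun i hi => ?_
        rw [smul_mul_assoc, hstep i (hCX hi), smul_smul]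
        simp [d, hi]
      · intro i hi hiC
        rw [smul_mul_assoc, hstep i hi]
        simp [d, hiC]
    rw [← Submodule.smul_mem_iff _ hL, ← hmain, ctr_eS, map_sum, Finset.mul_sum]
    refine Submodule.sum_mem _ fun s hs => ?_
    rw [map_smul, mul_smul_comm]
    refine Submodule.smul_mem _ _ ?_
    have hcs : (S.erase s).card = k := by
      rw [Finset.card_erase_of_mem hs]
      omega
    have := ih (hS.mono (Finset.erase_subset s S)) hcs
    have hmap := Submodule.mem_map_of_mem (f := LinearMap.mulLeft ℂ (A.omLamX lam X)) this
    rw [Submodule.map_span] at hmap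
    refine Submodule.span_mono ?_ hmap
    rintro _ ⟨_, ⟨l, ⟨hl1, hl2⟩, rfl⟩, rfl⟩
    have hXs : A.inter (insert s l.toFinset) = X := by
      rw [hX, ← Finset.insert_erase hs]
      ext x
      have h1 := congrArg (x ∈ ·) hl1
      simp only [mem_inter_iff, Finset.mem_insert, forall_eq_or_imp, eq_iff_iff] at h1 ⊢
      tauto
    refine ⟨s :: l, ⟨by rw [List.toFinset_cons, hXs], by rw [List.length_cons, hl2]⟩, ?_⟩
    rw [xiList, hXs]
    rfl

theorem deg_le_span_xiSet {lam : Fin n → ℂ}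
    (hlam : ∀ X, A.memL X → X ≠ A.amb → A.denseL X → A.lamX lam X ≠ 0) (p : ℕ) :
    A.deg p ≤ Submodule.span ℂ (A.xiSet lam '' (A.nbcF p : Set (Finset (Fin n)))) := by
  refine Submodule.span_le.2 ?_
  rintro _ ⟨S, rfl, rfl⟩
  by_cases hbot : A.inter S = ⊥
  · rw [omB, osMk_eS_eq_zero hbot]
    exact zero_mem _
  by_cases hlin : A.lin S
  · refine Submodule.span_le.2 ?_ (omB_mem_span_xiList hlam hlin)
    rintro _ ⟨l, ⟨hl1, hl2⟩, rfl⟩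
    have := xiList_mem_span (A := A) lam (l := l) (by rwa [hl1])
    rwa [hl2] at this
  · rw [omB, osMk_eS_eq_zero_of_dep ((dep_iff _).2 ⟨hbot, hlin⟩)]
    exact zero_mem _

end Dense

/-! ### Forms of nbc-bases -/

section Top

theorem list_map_orderIsoOfFin {M : Type*} (S T : Finset (Fin n)) (h : T.card = S.card)
    (hST : T = S) (g : Fin n → M) :
    (List.finRange S.card).map (fun p => g (T.orderIsoOfFin h p).1) =
      (S.sort (· ≤ ·)).map g := by
  subst hST
  rw [← Finset.listMap_orderEmbOfFin_finRange T h, List.map_map]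
  rfl

variable {A : HArr W n}

theorem xiList_eq_prod (lam : Fin n → ℂ) {l : List (Fin n)} (hl : l.SortedLT) :
    (l.map fun i => A.omLamX lam (A.inter (l.toFinset.filter (i ≤ ·)))).prod =
      A.xiList lam l := by
  induction l with
  | nil => simp [xiList]
  | cons i l ih =>
    have hlt := (List.pairwise_cons.1 hl.pairwise).1
    rw [xiList, ← ih (List.pairwise_cons.1 hl.pairwise).2.sortedLT, List.map_cons, List.prod_cons,
      List.toFinset_cons, Finset.filter_true_of_mem]
    · congr 2
      refine List.map_congr_left fun j hj => ?_
      rw [Finset.filter_insert, if_neg (hlt j hj).not_ge]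
    · intro j hj
      obtain rfl | hj := Finset.mem_insert.1 hj
      · exact le_rfl
      · exact (hlt j (List.mem_toFinset.1 hj)).le

theorem Xi_eq_xiSet (lam : Fin n → ℂ) (S : Finset (Fin n)) : A.Xi 1 lam S = A.xiSet lam S := by
  rw [xiSet, ← xiList_eq_prod lam (Finset.sortedLT_sort S), Finset.sort_toFinset,
    ← list_map_orderIsoOfFin S (S.image ⇑(1 : Equiv.Perm (Fin n)))
      (Finset.card_image_of_injective S (Equiv.injective _)) (by simp), Xi]
  rfl

theorem xiSet_mem_deg (lam : Fin n → ℂ) (S : Finset (Fin n)) :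
    A.xiSet lam S ∈ A.deg S.card := by
  rw [xiSet, ← osMk_dualForm_flagFun, dualForm_apply, map_sum]
  refine Submodule.sum_mem _ fun T _ => ?_
  rw [map_smul]
  by_cases h : A.flagFun (S.sort (· ≤ ·)) (eS T) = 0
  · rw [h, mul_zero, zero_smul]
    exact zero_mem _
  · exact Submodule.smul_mem _ _ (Submodule.subset_span ⟨T, setFun_support h, rfl⟩)

theorem osMk_dualForm_congr (lam : Fin n → ℂ)
    {φ ψ : Dual ℂ (ExteriorAlgebra ℂ (Fin n → ℂ))}
    (h : ∀ S, A.inter S ≠ ⊥ → φ (eS S) = ψ (eS S)) :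
    A.osMk (dualForm lam φ) = A.osMk (dualForm lam ψ) := by
  rw [dualForm_apply, dualForm_apply, map_sum, map_sum]
  refine Finset.sum_congr rfl fun S _ => ?_
  rw [map_smul, map_smul]
  by_cases hS : A.inter S = ⊥
  · rw [osMk_eS_eq_zero hS, smul_zero, smul_zero]
  · rw [h S hS]

variable [FiniteDimensional ℂ W]

open scoped Classical in
theorem setFun_del {p : ℕ} {T B : Finset (Fin n)} (hT : T ∈ A.nbcF p) (hB : B ∈ A.nbcF (p + 1)) :
    A.setFun T (del (eS B)) = cob (fun U => if U = T then 1 else 0) B := by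
  rw [del, ctr_eS, map_sum, cob]
  refine Finset.sum_congr rfl fun i hi => ?_
  rw [mem_nbcF] at hB
  rw [map_smul, setFun_nbcF hT, Pi.one_apply, one_mul, smul_eq_mul]
  refine mem_nbcF.2 ⟨nbcSet_mono hB.1 (Finset.erase_subset _ _), ?_⟩
  rw [Finset.card_erase_of_mem hi, hB.2, Nat.add_sub_cancel]

open scoped Classical in
theorem omLam_mul_xiSet (lam : Fin n → ℂ) {p : ℕ} {T : Finset (Fin n)} (hT : T ∈ A.nbcF p) :
    A.omLam lam * A.xiSet lam T =
      ∑ B ∈ A.nbcF (p + 1), cob (fun U => if U = T then 1 else 0) B • A.xiSet lam B := by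
  have hT' := mem_nbcF.1 hT
  have h1 := osMk_dualForm_eq (A := A) lam (p := p + 1)
    (φ := A.setFun T ∘ₗ del ∘ₗ prj (fun S => A.inter S ≠ ⊥)) (fun x hx => ?_) (fun S hS => ?_)
  · rw [osMk_dualForm_congr (ψ := A.setFun T ∘ₗ ctr 1), dualForm_comp_ctr, map_mul, setFun,
      osMk_dualForm_flagFun] at h1
    · simp only [Pi.one_apply, mul_one, map_sum, map_smul] at h1
      refine h1.trans (Finset.sum_congr rfl fun B hB => ?_)
      rw [LinearMap.comp_apply, LinearMap.comp_apply, prj_eS_pos (mem_nbcF.1 hB).1.1, ← setFun,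
        setFun_del hT hB]
    · intro S hS
      rw [LinearMap.comp_apply, LinearMap.comp_apply, LinearMap.comp_apply, prj_eS_pos hS]
  · exact setFun_eq_zero hT'.1.1 (osMk_del_prj_eq_zero (P := fun X => X ≠ ⊥)
      (fun X Y hXY hX hY => hX (le_bot_iff.1 (hY ▸ hXY))) (fun h => h rfl) hx)
  · by_cases hbot : A.inter S ≠ ⊥
    · rw [LinearMap.comp_apply, LinearMap.comp_apply, prj_eS_pos hbot, del, ctr_eS, map_sum] at hS
      obtain ⟨s, hs, hne⟩ := Finset.exists_ne_zero_of_sum_ne_zero hS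
      rw [map_smul, smul_eq_mul] at hne
      have hc := setFun_support (right_ne_zero_of_mul hne)
      rw [Finset.card_erase_of_mem hs, hT'.2] at hc
      have := Finset.card_pos.2 ⟨s, hs⟩
      omega
    · rw [LinearMap.comp_apply, LinearMap.comp_apply, prj_eS_neg hbot, map_zero, map_zero] at hS
      exact absurd rfl hS

theorem omLam_mul_sum (lam : Fin n → ℂ) (p : ℕ) (ψ : Finset (Fin n) → ℂ) :
    A.omLam lam * ∑ T ∈ A.nbcF p, ψ T • A.xiSet lam T =
      ∑ B ∈ A.nbcF (p + 1), cob ψ B • A.xiSet lam B := by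
  classical
  rw [Finset.mul_sum]
  have h : ∀ T ∈ A.nbcF p, A.omLam lam * ψ T • A.xiSet lam T =
      ∑ B ∈ A.nbcF (p + 1), (ψ T * cob (fun U => if U = T then 1 else 0) B) • A.xiSet lam B := by
    intro T hT
    rw [mul_smul_comm, omLam_mul_xiSet lam hT, Finset.smul_sum]
    simp only [smul_smul]
  rw [Finset.sum_congr rfl h, Finset.sum_comm]
  refine Finset.sum_congr rfl fun B hB => ?_
  rw [← Finset.sum_smul]
  congr 1
  simp only [cob, Finset.mul_sum]
  rw [Finset.sum_comm]
  refine Finset.sum_congr rfl fun i hi => ?_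
  rw [Finset.sum_eq_single (B.erase i), if_pos rfl]
  · ring
  · intro T _ hT
    rw [if_neg hT.symm, mul_zero, mul_zero]
  · intro hni
    rw [mem_nbcF] at hB
    refine absurd (mem_nbcF.2 ⟨nbcSet_mono hB.1 (Finset.erase_subset _ _), ?_⟩) hni
    rw [Finset.card_erase_of_mem hi, hB.2, Nat.add_sub_cancel]

theorem linearIndependent_omB (p : ℕ) :
    LinearIndependent ℂ (fun B : A.nbcF p => A.omB B.1) := by
  classical
  rw [Fintype.linearIndependent_iff]
  intro c hc B
  have h : A.osMk (∑ B, c B • eS B.1) = 0 := by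
    simpa [omB] using hc
  have h2 := setFun_eq_zero (mem_nbcF.1 B.2).1.1 h
  rw [map_sum, Finset.sum_eq_single B] at h2
  · rw [map_smul, setFun_nbcF B.2 B.2, if_pos rfl, smul_eq_mul, mul_one] at h2
    exact h2
  · intro B' _ hne
    rw [map_smul, setFun_nbcF B.2 B'.2, if_neg fun h => hne (Subtype.ext h), smul_zero]
  · exact fun h => absurd (Finset.mem_univ _) h

theorem linearIndependent_xiSet {lam : Fin n → ℂ}
    (hlam : ∀ X, A.memL X → X ≠ A.amb → A.denseL X → A.lamX lam X ≠ 0) (p : ℕ) :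
    LinearIndependent ℂ (fun B : A.nbcF p => A.xiSet lam B.1) := by
  have hr : ∀ f : Finset (Fin n) → OS A, Set.range (fun B : A.nbcF p => f B.1) =
      f '' (A.nbcF p : Set (Finset (Fin n))) := fun f => by
    rw [Set.image_eq_range]; rfl
  have h1 : Submodule.span ℂ (Set.range fun B : A.nbcF p => A.omB B.1) = A.deg p := by
    rw [hr]
    refine le_antisymm (Submodule.span_mono ?_) (Submodule.span_le.2 ?_)
    · rintro _ ⟨B, hB, rfl⟩
      exact ⟨B, (mem_nbcF.1 hB).2, rfl⟩
    · rintro _ ⟨S, rfl, rfl⟩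
      exact omB_mem_span_nbcF S
  have h2 : Submodule.span ℂ (Set.range fun B : A.nbcF p => A.xiSet lam B.1) = A.deg p := by
    rw [hr]
    refine le_antisymm (Submodule.span_le.2 ?_) (deg_le_span_xiSet hlam p)
    rintro _ ⟨B, hB, rfl⟩
    rw [← (mem_nbcF.1 hB).2]
    exact xiSet_mem_deg lam B
  have h3 := linearIndependent_iff_card_eq_finrank_span.1 (linearIndependent_omB (A := A) p)
  rw [linearIndependent_iff_card_eq_finrank_span, h3, Set.finrank, Set.finrank, h1, h2]

end Top

/-! ### βnbc-bases -/

section Beta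

variable {A : HArr W n}

/-- The sum of the indices of the elements of `F`. -/
def weight (F : Finset (Fin n)) : ℕ := ∑ i ∈ F, (i : ℕ)

open scoped Classical in
/-- The elements of a base `F` that cannot be exchanged for a smaller hyperplane. -/
def unexchangeable (A : HArr W n) (F : Finset (Fin n)) : Finset (Fin n) :=
  F.filter fun i => ∀ j < i, ¬ A.isBase (insert j (F.erase i))

theorem mem_unexchangeable {F : Finset (Fin n)} {i : Fin n} :
    i ∈ A.unexchangeable F ↔ i ∈ F ∧ ∀ j < i, ¬ A.isBase (insert j (F.erase i)) := by
  classical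
  exact Finset.mem_filter

theorem card_erase_nbcF {F : Finset (Fin n)} (hF : F ∈ A.nbcF A.rank) {i : Fin n} (hi : i ∈ F) :
    (F.erase i).card + 1 = A.rank := by
  rw [Finset.card_erase_add_one hi, (mem_nbcF.1 hF).2]

variable [FiniteDimensional ℂ W]

theorem mem_spn_of_not_isBase {T : Finset (Fin n)} (hT : A.lin T) (hc : T.card + 1 = A.rank)
    {h : Fin n} (hb : ¬ A.isBase (insert h T)) : A.nrm h ∈ A.spn T := by
  by_contra hn
  refine hb ((isBase_iff _).2 ⟨hT.insert_of_notMem hn, ?_⟩)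
  rw [Finset.card_insert_of_notMem fun hh => hn (A.nrm_mem_spn hh), hc]

theorem nbcF_lin {p : ℕ} {F : Finset (Fin n)} (hF : F ∈ A.nbcF p) : A.lin F :=
  lin_of_nbcSet (mem_nbcF.1 hF).1

theorem betaNbcBase_iff {F : Finset (Fin n)} :
    A.betaNbcBase 1 F ↔ F ∈ A.nbcF A.rank ∧ A.unexchangeable F = ∅ := by
  rw [betaNbcBase, nbcBase_iff, mem_nbcF, Finset.eq_empty_iff_forall_notMem]
  refine and_congr_right fun _ => forall_congr' fun i => ?_
  rw [mem_unexchangeable]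
  push Not
  rfl

theorem mem_spn_erase_of_unexchangeable {F : Finset (Fin n)} (hF : F ∈ A.nbcF A.rank)
    {k h : Fin n} (hk : k ∈ A.unexchangeable F) (hh : h < k) : A.nrm h ∈ A.spn (F.erase k) := by
  obtain ⟨hkF, hk⟩ := mem_unexchangeable.1 hk
  exact mem_spn_of_not_isBase ((nbcF_lin hF).mono (Finset.erase_subset _ _))
    (card_erase_nbcF hF hkF) (hk h hh)

theorem exists_weight_lt {F : Finset (Fin n)} (hF : F ∈ A.nbcF A.rank) {i : Fin n} (hi : i ∈ F)
    (hiN : i ∉ A.unexchangeable F) :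
    ∃ F' ∈ A.nbcF A.rank, F.erase i ⊆ F' ∧ weight F' < weight F := by
  classical
  have hex : ∃ j, j < i ∧ A.isBase (insert j (F.erase i)) := by
    by_contra! hcon
    exact hiN (mem_unexchangeable.2 ⟨hi, hcon⟩)
  obtain ⟨j, ⟨hji, hj⟩, hmin⟩ := WellFounded.has_min (wellFounded_lt (α := Fin n))
    {j | j < i ∧ A.isBase (insert j (F.erase i))} hex
  have hjT : j ∉ F.erase i := fun hjT => by
    have h1 := ((isBase_iff _).1 hj).2
    have h2 := card_erase_nbcF hF hi
    rw [Finset.insert_eq_of_mem hjT] at h1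
    omega
  refine ⟨insert j (F.erase i), mem_nbcF.2 ⟨?_, ((isBase_iff _).1 hj).2⟩,
    Finset.subset_insert _ _, ?_⟩
  · refine nbcSet_insert (nbcSet_mono (mem_nbcF.1 hF).1 (Finset.erase_subset _ _))
      ((isBase_iff _).1 hj).1 hjT fun h hh => ?_
    exact mem_spn_of_not_isBase ((nbcF_lin hF).mono (Finset.erase_subset _ _))
      (card_erase_nbcF hF hi) fun hb => hmin h ⟨hh.trans hji, hb⟩ hh
  · rw [weight, weight, Finset.sum_insert hjT, ← Finset.add_sum_erase F (fun i => (i : ℕ)) hi]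
    exact Nat.add_lt_add_right hji _

theorem weight_lt_of_erase_subset {F F' : Finset (Fin n)} (hF : F ∈ A.nbcF A.rank) {k : Fin n}
    (hk : k ∈ A.unexchangeable F) (hF' : F' ∈ A.nbcF A.rank) (hsub : F.erase k ⊆ F')
    (hne : F' ≠ F) : weight F < weight F' := by
  have hkF := (mem_unexchangeable.1 hk).1
  have hcard : (F' \ F.erase k).card = 1 := by
    rw [Finset.card_sdiff_of_subset hsub, (mem_nbcF.1 hF').2, ← card_erase_nbcF hF hkF]
    omega
  obtain ⟨a, ha⟩ := Finset.card_eq_one.1 hcard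
  have haF' : a ∈ F' \ F.erase k := ha ▸ Finset.mem_singleton_self a
  obtain ⟨-, haT⟩ := Finset.mem_sdiff.1 haF'
  have hF'eq : F' = insert a (F.erase k) := by
    rw [← Finset.sdiff_union_of_subset hsub, ha, Finset.insert_eq]
  have hak : k < a := by
    refine lt_of_le_of_ne (not_lt.1 fun hlt => ?_) ?_
    · have := nbcF_lin hF'
      rw [hF'eq, lin_insert haT] at this
      exact this.2 (mem_spn_erase_of_unexchangeable hF hk hlt)
    · rintro rfl
      exact hne (hF'eq.trans (Finset.insert_erase hkF))
  rw [hF'eq, weight, weight, Finset.sum_insert haT,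
    ← Finset.add_sum_erase F (fun i => (i : ℕ)) hkF]
  exact Nat.add_lt_add_right hak _

theorem weight_lt_of_erase_erase_subset {F F' : Finset (Fin n)} (hF : F ∈ A.nbcF A.rank)
    {k l : Fin n} (hk : k ∈ A.unexchangeable F) (hl : l ∈ A.unexchangeable F) (hkl : k < l)
    (hF' : F' ∈ A.nbcF A.rank) (hsub : (F.erase k).erase l ⊆ F') (hne : F' ≠ F) :
    weight F < weight F' := by
  have hkF := (mem_unexchangeable.1 hk).1
  have hlF := (mem_unexchangeable.1 hl).1
  have hlFk : l ∈ F.erase k := Finset.mem_erase.2 ⟨hkl.ne', hlF⟩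
  have hkFl : k ∈ F.erase l := Finset.mem_erase.2 ⟨hkl.ne, hkF⟩
  set T := (F.erase k).erase l with hT
  have hT' : T = (F.erase l).erase k := Finset.erase_right_comm
  have hTk : F.erase k = insert l T := (Finset.insert_erase hlFk).symm
  have hTl : F.erase l = insert k T := by rw [hT', Finset.insert_erase hkFl]
  have hTcard : T.card + 2 = A.rank := by
    rw [← card_erase_nbcF hF hkF, ← Finset.card_erase_add_one hlFk]
  have hcard : (F' \ T).card = 2 := by
    rw [Finset.card_sdiff_of_subset hsub, (mem_nbcF.1 hF').2]
    omega
  have hab : ∃ a b, a < b ∧ F' \ T = {a, b} := by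
    obtain ⟨a, b, hne, h⟩ := Finset.card_eq_two.1 hcard
    rcases hne.lt_or_gt with h' | h'
    · exact ⟨a, b, h', h⟩
    · exact ⟨b, a, h', h.trans (Finset.pair_comm _ _)⟩
  obtain ⟨a, b, hab, h⟩ := hab
  have haT : a ∉ T := (Finset.mem_sdiff.1 (h ▸ Finset.mem_insert_self a {b} : a ∈ F' \ T)).2
  have hbT : b ∉ T := (Finset.mem_sdiff.1
    (h ▸ Finset.mem_insert_of_mem (Finset.mem_singleton_self b) : b ∈ F' \ T)).2
  have hF'eq : F' = insert a (insert b T) := by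
    rw [← Finset.sdiff_union_of_subset hsub, h, Finset.insert_eq, Finset.insert_eq,
      Finset.insert_eq, Finset.union_assoc]
  have habT : a ∉ insert b T := by simp [hab.ne, haT]
  have hP1 : ∀ h < k, A.nrm h ∈ A.spn (insert l T) := fun h hh =>
    hTk ▸ mem_spn_erase_of_unexchangeable hF hk hh
  have hP2 : ∀ h < l, A.nrm h ∈ A.spn (insert k T) := fun h hh =>
    hTl ▸ mem_spn_erase_of_unexchangeable hF hl hh
  have hlin := nbcF_lin hF'
  have hlspn : A.nrm l ∉ A.spn (insert k T) := by
    have := nbcF_lin hF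
    rw [← Finset.insert_erase hlF, lin_insert (Finset.notMem_erase _ _), hTl] at this
    exact this.2
  have hP3 : ∀ h < k, A.nrm h ∈ A.spn T := by
    intro h hh
    by_contra hn
    refine hlspn (spn_le (P := A.spn (insert k T)) (fun i hi => ?_) (exchange (hP1 h hh) hn))
    obtain rfl | hi := Finset.mem_insert.1 hi
    · exact hP2 _ (hh.trans hkl)
    · exact A.nrm_mem_spn (Finset.mem_insert_of_mem hi)
  have hka : k ≤ a := by
    refine not_lt.1 fun hlt => ?_
    rw [hF'eq, lin_insert habT] at hlin
    exact hlin.2 (A.spn_mono (Finset.subset_insert _ _) (hP3 a hlt))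
  have hlb : l ≤ b := by
    refine not_lt.1 fun hlt => ?_
    have hle : A.spn F' ≤ A.spn (insert k T) := by
      refine spn_le fun i hi => ?_
      rw [hF'eq] at hi
      obtain rfl | hi := Finset.mem_insert.1 hi
      · exact hP2 _ (hab.trans hlt)
      obtain rfl | hi := Finset.mem_insert.1 hi
      · exact hP2 _ hlt
      · exact A.nrm_mem_spn (Finset.mem_insert_of_mem hi)
    have h1 := Submodule.finrank_mono hle
    rw [(lin_iff_finrank F').1 hlin, (mem_nbcF.1 hF').2] at h1
    have h2 := h1.trans (finrank_spn_le _)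
    have h3 := h2.trans (Finset.card_insert_le _ _)
    omega
  have hw' : weight F' = a + (b + weight T) := by
    rw [hF'eq, weight, Finset.sum_insert habT, Finset.sum_insert hbT, weight]
  have hw : weight F = k + (l + weight T) := by
    rw [weight, ← Finset.add_sum_erase F (fun i => (i : ℕ)) hkF,
      ← Finset.add_sum_erase (F.erase k) (fun i => (i : ℕ)) hlFk, weight]
  have hneq : ¬ (a = k ∧ b = l) := by
    rintro ⟨rfl, rfl⟩
    refine hne ?_
    rw [hF'eq, ← hTk, Finset.insert_erase hkF]
  rw [Fin.ext_iff, Fin.ext_iff] at hneq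
  rw [Fin.le_def] at hka hlb
  omega

/-- The nbc-bases, ordered by weight, are shelled. -/
theorem weight_lt_of_unexchangeable {F F' : Finset (Fin n)} (hF : F ∈ A.nbcF A.rank) {k l : Fin n}
    (hk : k ∈ A.unexchangeable F) (hl : l ∈ A.unexchangeable F)
    (hF' : F' ∈ A.nbcF A.rank) (hsub : (F.erase k).erase l ⊆ F') (hne : F' ≠ F) :
    weight F < weight F' := by
  rcases lt_trichotomy k l with h | rfl | h
  · exact weight_lt_of_erase_erase_subset hF hk hl h hF' hsub hne
  · rw [Finset.erase_idem] at hsub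
    exact weight_lt_of_erase_subset hF hk hF' hsub hne
  · rw [Finset.erase_right_comm] at hsub
    exact weight_lt_of_erase_erase_subset hF hl hk h hF' hsub hne

theorem cob_eq_zero_of_beta (ψ : Finset (Fin n) → ℂ)
    (hψ : ∀ F ∈ A.nbcF A.rank, (A.unexchangeable F).Nonempty → cob ψ F = 0) :
    ∀ F ∈ A.nbcF A.rank, cob ψ F = 0 :=
  cob_eq_zero_of_shelling (A.nbcF A.rank) A.unexchangeable weight A.rank
    (fun _ hF => (mem_nbcF.1 hF).2) (fun _ _ _ hi => (mem_unexchangeable.1 hi).1)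
    (fun _ hF _ hi hiN => exists_weight_lt hF hi hiN)
    (fun _ hF _ hk _ hl _ hF' hsub hne => weight_lt_of_unexchangeable hF hk hl hF' hsub hne) ψ hψ

theorem xiSet_mem_sup (lam : Fin n → ℂ) {B : Finset (Fin n)} (hB : B ∈ A.nbcF A.rank) :
    A.xiSet lam B ∈ Submodule.span ℂ (A.xiSet lam '' {S | A.betaNbcBase 1 S}) ⊔
      A.Ideg lam (A.rank - 1) := by
  classical
  obtain ⟨K, hK⟩ : ∃ K, ∀ B' : Finset (Fin n), weight B' ≤ K :=
    ⟨weight Finset.univ, fun B' => Finset.sum_le_sum_of_subset (Finset.subset_univ _)⟩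
  induction hm : K - weight B using Nat.strong_induction_on generalizing B with
  | _ m ih =>
  by_cases hβ : A.betaNbcBase 1 B
  · exact Submodule.mem_sup_left (Submodule.subset_span ⟨B, hβ, rfl⟩)
  obtain ⟨i, hi⟩ : (A.unexchangeable B).Nonempty := by
    rw [Finset.nonempty_iff_ne_empty]
    exact fun h => hβ (betaNbcBase_iff.2 ⟨hB, h⟩)
  have hiB := (mem_unexchangeable.1 hi).1
  have hc := card_erase_nbcF hB hiB
  have hT : B.erase i ∈ A.nbcF (A.rank - 1) :=
    mem_nbcF.2 ⟨nbcSet_mono (mem_nbcF.1 hB).1 (Finset.erase_subset _ _), by omega⟩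
  have hmul := omLam_mul_xiSet lam hT
  rw [show A.rank - 1 + 1 = A.rank by omega, ← Finset.add_sum_erase _ _ hB] at hmul
  have hcoef : cob (fun U => if U = B.erase i then (1 : ℂ) else 0) B = sg i B := by
    rw [cob, Finset.sum_eq_single_of_mem i hiB, if_pos rfl, mul_one]
    intro j hj hji
    exact mul_eq_zero_of_right _ (if_neg fun h => hji ((Finset.erase_inj _ hj).1 h))
  rw [hcoef] at hmul
  rw [← Submodule.smul_mem_iff _ (sg_ne_zero i B), ← sub_eq_iff_eq_add.2 hmul]
  refine Submodule.sub_mem _ (Submodule.mem_sup_right ?_) (Submodule.sum_mem _ fun B' hB' => ?_)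
  · refine Submodule.mem_map.2 ⟨_, ?_, rfl⟩
    rw [← (mem_nbcF.1 hT).2]
    exact xiSet_mem_deg lam _
  · obtain ⟨hne, hB'⟩ := Finset.mem_erase.1 hB'
    by_cases hcz : cob (fun U => if U = B.erase i then (1 : ℂ) else 0) B' = 0
    · rw [hcz, zero_smul]
      exact Submodule.zero_mem _
    · refine Submodule.smul_mem _ _ ?_
      have hsub : B.erase i ⊆ B' := by
        obtain ⟨j, hj, hjne⟩ := Finset.exists_ne_zero_of_sum_ne_zero hcz
        have : B'.erase j = B.erase i := by
          by_contra hcon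
          exact hjne (mul_eq_zero_of_right _ (if_neg hcon))
        exact this ▸ Finset.erase_subset _ _
      have hlt := weight_lt_of_erase_subset hB hi hB' hsub hne
      have := hK B'
      exact ih (K - weight B') (by omega) hB' rfl

theorem eq_zero_of_rank_eq_zero (h : A.rank = 0) : n = 0 := by
  by_contra hn
  have hi : A.lin {(⟨0, Nat.pos_of_ne_zero hn⟩ : Fin n)} := by
    simp [lin, A.nrm_ne_zero]
  have := hi.card_le_rank
  simp [h] at this

/-- Elements of `ω_λ ∧ A^{r-1}` are given by coboundaries in the `Ξ`-basis. -/
theorem exists_cob_of_mem_Ideg {lam : Fin n → ℂ}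
    (hlam : ∀ X, A.memL X → X ≠ A.amb → A.denseL X → A.lamX lam X ≠ 0) {x : OS A}
    (hx : x ∈ A.Ideg lam (A.rank - 1)) :
    ∃ ψ : Finset (Fin n) → ℂ, x = ∑ B ∈ A.nbcF A.rank, cob ψ B • A.xiSet lam B := by
  classical
  obtain ⟨y, hy, rfl⟩ := Submodule.mem_map.1 hx
  rw [LinearMap.mulLeft_apply]
  by_cases hr : A.rank = 0
  · obtain rfl := eq_zero_of_rank_eq_zero (A := A) hr
    exact ⟨0, by simp [omLam, cob]⟩
  · have h := deg_le_span_xiSet hlam (A.rank - 1) hy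
    obtain ⟨ψ, rfl⟩ := (Submodule.mem_span_image_finset_iff_exists_fun' ℂ).1 h
    have hsum := omLam_mul_sum (A := A) lam (A.rank - 1) ψ
    rw [show A.rank - 1 + 1 = A.rank by omega] at hsum
    exact ⟨_, hsum⟩

theorem cob_eq_zero_of_sum_mem_Ideg {lam : Fin n → ℂ}
    (hlam : ∀ X, A.memL X → X ≠ A.amb → A.denseL X → A.lamX lam X ≠ 0)
    (c : Finset (Fin n) → ℂ) (hc : ∀ B, ¬ A.betaNbcBase 1 B → c B = 0)
    (h : ∑ B ∈ A.nbcF A.rank, c B • A.xiSet lam B ∈ A.Ideg lam (A.rank - 1)) :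
    ∀ B ∈ A.nbcF A.rank, c B = 0 := by
  obtain ⟨ψ, hψ⟩ := exists_cob_of_mem_Ideg hlam h
  have hcψ : ∀ B ∈ A.nbcF A.rank, c B = cob ψ B := by
    intro B hB
    have hli := Fintype.linearIndependent_iff.1 (linearIndependent_xiSet (A := A) hlam A.rank)
      (fun B => c B.1 - cob ψ B.1) ?_ ⟨B, hB⟩
    · exact sub_eq_zero.1 hli
    · rw [Finset.sum_coe_sort (A.nbcF A.rank) fun B => (c B - cob ψ B) • A.xiSet lam B]
      simp only [sub_smul, Finset.sum_sub_distrib, hψ, sub_self]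
  intro B hB
  rw [hcψ B hB]
  refine cob_eq_zero_of_beta ψ (fun F hF hne => ?_) B hB
  rw [← hcψ F hF]
  exact hc F fun hβ => hne.ne_empty (betaNbcBase_iff.1 hβ).2

end Beta

end HArr

open scoped Classical
/-- If `λ(X) ≠ 0` for every dense `X ∈ L ∖ {V}`, then the residue
classes `{[Ξ(B)] : B ∈ βnbc(𝒜)}` form a ℂ-basis of `H^r(A^•, ω_λ∧) = A^r/(ω_λ ∧ A^{r−1})`:
they are linearly independent modulo `ω_λ ∧ A^{r−1}` and together with `ω_λ ∧ A^{r−1}`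
they span `A^r`. -/
theorem Xi_betaNbc_basis_top_cohomology {W : Type} [AddCommGroup W] [Module ℂ W]
    [FiniteDimensional ℂ W] {n : ℕ} (A : HArr W n) (lam : Fin n → ℂ)
    (hlam : ∀ X, A.memL X → X ≠ A.amb → A.denseL X → A.lamX lam X ≠ 0) :
    (∀ c : {S : Finset (Fin n) // A.betaNbcBase 1 S} → ℂ,
      (∑ B, c B • A.Xi 1 lam B.1) ∈ A.Ideg lam (A.rank - 1) → ∀ B, c B = 0) ∧
    A.deg A.rank ≤
      Submodule.span ℂ
        (Set.range fun B : {S : Finset (Fin n) // A.betaNbcBase 1 S} => A.Xi 1 lam B.1) ⊔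
      A.Ideg lam (A.rank - 1) := by
  constructor
  · intro c hc B
    set c' : Finset (Fin n) → ℂ := fun S => if h : A.betaNbcBase 1 S then c ⟨S, h⟩ else 0 with hc'
    have hB := HArr.betaNbcBase_iff.1 B.2
    have hsum : ∑ S ∈ A.nbcF A.rank, c' S • A.xiSet lam S = ∑ B, c B • A.Xi 1 lam B.1 := by
      symm
      refine Finset.sum_bij_ne_zero (fun S _ _ => S.1) ?_ ?_ ?_ ?_
      · exact fun S _ _ => (HArr.betaNbcBase_iff.1 S.2).1
      · exact fun S _ _ T _ _ h => Subtype.ext h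
      · intro S _ hne
        by_cases hS : A.betaNbcBase 1 S
        · refine ⟨⟨S, hS⟩, Finset.mem_univ _, ?_, rfl⟩
          simpa [hc', hS, HArr.Xi_eq_xiSet] using hne
        · simp [hc', hS] at hne
      · intro S _ _
        simp [hc', S.2, HArr.Xi_eq_xiSet]
    have h := HArr.cob_eq_zero_of_sum_mem_Ideg hlam c' (fun S hS => by simp [hc', hS])
      (hsum ▸ hc) B.1 hB.1
    simpa [hc', B.2] using h
  · refine (HArr.deg_le_span_xiSet hlam A.rank).trans (Submodule.span_le.2 ?_)
    rintro _ ⟨B, hB, rfl⟩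
    have h := HArr.xiSet_mem_sup lam hB
    rw [Set.image_eq_range] at h
    simp only [HArr.Xi_eq_xiSet]
    exact h
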